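/- arXiv:1408.1458 — 3 statements merged into one kernel-verified Lean document; each statement's English description precedes it below -/
import Mathlib

section
/- Let M be a queue machine and ρ_M the induced stream biGSOS law. Then ρ_M extends to exactly one distributive law if and only if M does not terminate from the initial configuration (q1, $); moreover, if M terminates from (q1, $), then ρ_M extends to no distributive law at all. -/
/-- Σ-terms over a signature: `Op` is the set of operation symbols, `ar` the arity. -/
inductive Term (Op : Type) (ar : Op → ℕ) (X : Type) : Type
  | var : X → Term Op ar X
  | op : (o : Op) → (Fin (ar o) → Term Op ar X) → Term Op ar X

namespace Term
variable {Op : Type} {ar : Op → ℕ}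

/-- Functorial action of `Σ*` (term substitution of variables). -/
def map {X Y : Type} (f : X → Y) : Term Op ar X → Term Op ar Y
  | var x => var (f x)
  | op o ts => op o fun i => (ts i).map f

/-- Multiplication `μ` of the free monad: flattening of terms of terms. -/
def join {X : Type} : Term Op ar (Term Op ar X) → Term Op ar X
  | var t => t
  | op o ts => op o fun i => (ts i).join

end Term

/-- Comultiplication `δ` of the cofree comonad on `B X = A × X`:
color each position of a stream with the tail starting there. -/
def sTails {A X : Type} (σ : Stream' (X × A)) : Stream' (Stream' (X × A) × A) :=
  fun n => (σ.drop n, (σ n).2)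

/-- The first transition of a stream: its first label together with its second state. -/
def firstTrans {A Z : Type} (s : Stream' (Z × A)) : A × Z := ((s 0).2, (s 1).1)

/-- A distributive law of the free monad `Σ*` over the cofree comonad `B^∞`
for the stream behaviour `B X = A × X`: a natural family
`λ_X : Σ*(B^∞ X) → B^∞(Σ* X)` satisfying the four axioms (i)-(iv). -/
structure DistLaw (Op : Type) (ar : Op → ℕ) (A : Type) : Type 1 where
  law : ∀ X : Type, Term Op ar (Stream' (X × A)) → Stream' (Term Op ar X × A)
  natural : ∀ (X Y : Type) (f : X → Y) (u : Term Op ar (Stream' (X × A))),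
      law Y (u.map (Stream'.map (Prod.map f id))) =
        Stream'.map (Prod.map (Term.map f) id) (law X u)
  /-- (i): on a bare stream, `λ` returns the same stream, states regarded as terms. -/
  ax_unit : ∀ (X : Type) (σ : Stream' (X × A)),
      law X (Term.var σ) = Stream'.map (Prod.map Term.var id) σ
  /-- (ii): the first state of `λ_X u` is `u` with each stream replaced by its first state. -/
  ax_counit : ∀ (X : Type) (u : Term Op ar (Stream' (X × A))),
      (law X u 0).1 = u.map fun σ => (σ 0).1
  /-- (iii): compositionality with respect to terms. -/
  ax_mult : ∀ (X : Type) (u : Term Op ar (Term Op ar (Stream' (X × A)))),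
      law X u.join =
        Stream'.map (Prod.map Term.join id) (law (Term Op ar X) (u.map (law X)))
  /-- (iv): decompositionality with respect to streams (`δΣ* ∘ λ = B^∞λ ∘ λB^∞ ∘ Σ*δ`):
  applying `λ_X` to the n-th state of `λ_X u`, with each variable occurrence replaced by
  the residual input stream starting at it, yields the n-th tail of `λ_X u`. -/
  ax_comult : ∀ (X : Type) (u : Term Op ar (Stream' (X × A))),
      Stream'.map (Prod.map (law X) id) (law (Stream' (X × A)) (u.map sTails)) =
        sTails (law X u)

/-- A queue machine `M = (Q, A, $, q1, δ0, δ1, δ2)`: a finite set `Q` of states, a finite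
alphabet `A` with a chosen symbol `$ ∈ A`, a starting state `q1 ∈ Q`, and three partial
transition functions `δ0, δ1, δ2` that are disjointly defined and jointly total. -/
structure QM : Type 1 where
  Q : Type
  A : Type
  fintypeQ : Fintype Q
  fintypeA : Fintype A
  dollar : A
  q1 : Q
  d0 : Q → Option (Q × A)
  d1 : Q → A → Option (Q × A)
  d2 : Q → A → A → Option (Q × A)
  /-- for each `q, a, b`, exactly one of `δ0(q)`, `δ1(q,a)`, `δ2(q,a,b)` is defined -/
  exactOne : ∀ q a b,
      ((d0 q).isSome ∧ d1 q a = none ∧ d2 q a b = none) ∨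
      (d0 q = none ∧ (d1 q a).isSome ∧ d2 q a b = none) ∨
      (d0 q = none ∧ d1 q a = none ∧ (d2 q a b).isSome)

/-- The step relation on configurations `(q, w) ∈ Q × A*`:
`(q, w) → (q', w·c)` if `δ0(q) = (q', c)`;
`(q, a·w) → (q', w·c)` if `δ0(q)` is undefined and `δ1(q, a) = (q', c)`;
`(q, a·b·w) → (q', w·c)` if `δ0(q), δ1(q, a)` are undefined and `δ2(q, a, b) = (q', c)`. -/
inductive QM.Step (M : QM) : M.Q × List M.A → M.Q × List M.A → Prop
  | step0 {q w q' c} : M.d0 q = some (q', c) → QM.Step M (q, w) (q', w ++ [c])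
  | step1 {q a w q' c} : M.d0 q = none → M.d1 q a = some (q', c) →
      QM.Step M (q, a :: w) (q', w ++ [c])
  | step2 {q a b w q' c} : M.d0 q = none → M.d1 q a = none → M.d2 q a b = some (q', c) →
      QM.Step M (q, a :: b :: w) (q', w ++ [c])

/-- A configuration with no successor. -/
def QM.Stuck (M : QM) (cfg : M.Q × List M.A) : Prop := ∀ c', ¬ M.Step cfg c'

/-- `M` terminates from the initial configuration `(q1, $)`: some finite sequence of
steps reaches a configuration with no successor. -/
def QM.Terminates (M : QM) : Prop :=
  ∃ cfg, Relation.ReflTransGen M.Step (M.q1, [M.dollar]) cfg ∧ M.Stuck cfg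

/-- The signature induced by a queue machine: one constant `C` (symbol `none`) and a
unary operation symbol for every state `q ∈ Q` (symbols `some q`). -/
def QM.Op (M : QM) : Type := Option M.Q

/-- Arities for the signature of a queue machine. -/
def QM.ar (M : QM) : M.Op → ℕ := fun o => o.elim 0 fun _ => 1

/-- The constant term `C`. -/
def QM.CT (M : QM) (X : Type) : Term M.Op M.ar X := Term.op none Fin.elim0

/-- Application of the unary operation symbol `q`. -/
def QM.qT (M : QM) {X : Type} (q : M.Q) (t : Term M.Op M.ar X) : Term M.Op M.ar X :=
  Term.op (some q) fun _ => t

/-- A distributive law `λ` extends the biGSOS law `ρ_M` induced by the queue machine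
`M` (given by the rules `C →$ q1(C)`; `q(x0 →a0 ⋯) →c q'(x0)` if `δ0(q) = (q', c)`;
`q(x0 →a0 x1 →a1 ⋯) →c q'(x1)` if `δ0(q)` is undefined and `δ1(q, a0) = (q', c)`;
`q(x0 →a0 x1 →a1 x2 →a2 ⋯) →c q'(x2)` if `δ0(q), δ1(q, a0)` are undefined and
`δ2(q, a0, a1) = (q', c)`) if for every set `X` and every `t ∈ Σ(B^∞ X)` the first
transition of `λ_X(ι(t))` (its first label together with its second state) equals
`ρ_M` applied to `t`. -/
def QM.ExtendsRho (M : QM) (lam : DistLaw M.Op M.ar M.A) : Prop :=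
  (∀ X : Type,
    firstTrans (lam.law X (M.CT (Stream' (X × M.A)))) = (M.dollar, M.qT M.q1 (M.CT X))) ∧
  (∀ (X : Type) (q : M.Q) (σ : Stream' (X × M.A)) (q' : M.Q) (c : M.A),
    M.d0 q = some (q', c) →
    firstTrans (lam.law X (M.qT q (Term.var σ))) = (c, M.qT q' (Term.var (σ 0).1))) ∧
  (∀ (X : Type) (q : M.Q) (σ : Stream' (X × M.A)) (q' : M.Q) (c : M.A),
    M.d0 q = none → M.d1 q (σ 0).2 = some (q', c) →
    firstTrans (lam.law X (M.qT q (Term.var σ))) = (c, M.qT q' (Term.var (σ 1).1))) ∧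
  (∀ (X : Type) (q : M.Q) (σ : Stream' (X × M.A)) (q' : M.Q) (c : M.A),
    M.d0 q = none → M.d1 q (σ 0).2 = none → M.d2 q (σ 0).2 (σ 1).2 = some (q', c) →
    firstTrans (lam.law X (M.qT q (Term.var σ))) = (c, M.qT q' (Term.var (σ 2).1)))


namespace QMP

variable {M : QM}

/-- One transducer step reading the label sequence `l`. -/
def next (l : ℕ → M.A) (s : M.Q × ℕ) : (M.Q × ℕ) × M.A :=
  match M.d0 s.1 with
  | some r => ((r.1, s.2), r.2)
  | none =>
    match M.d1 s.1 (l s.2) with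
    | some r => ((r.1, s.2 + 1), r.2)
    | none =>
      match M.d2 s.1 (l s.2) (l (s.2 + 1)) with
      | some r => ((r.1, s.2 + 2), r.2)
      | none => (s, l s.2)

def conf (l : ℕ → M.A) (q : M.Q) : ℕ → M.Q × ℕ
  | 0 => (q, 0)
  | n + 1 => (next l (conf l q n)).1

def nx (l : ℕ → M.A) (q : M.Q) (n : ℕ) : (M.Q × ℕ) × M.A := next l (conf l q n)

theorem conf_succ (l : ℕ → M.A) (q : M.Q) (n : ℕ) : conf l q (n + 1) = (nx l q n).1 := rfl

/-- The four cases of `next`. -/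
theorem next_cases (l : ℕ → M.A) (q : M.Q) (p : ℕ) :
    (∃ q' c, M.d0 q = some (q', c) ∧ next l (q, p) = ((q', p), c)) ∨
    (∃ q' c, M.d0 q = none ∧ M.d1 q (l p) = some (q', c) ∧ next l (q, p) = ((q', p + 1), c)) ∨
    (∃ q' c, M.d0 q = none ∧ M.d1 q (l p) = none ∧ M.d2 q (l p) (l (p + 1)) = some (q', c) ∧
      next l (q, p) = ((q', p + 2), c)) := by
  rcases h0 : M.d0 q with _ | ⟨q', c⟩
  · rcases h1 : M.d1 q (l p) with _ | ⟨q', c⟩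
    · rcases h2 : M.d2 q (l p) (l (p + 1)) with _ | ⟨q', c⟩
      · have := M.exactOne q (l p) (l (p + 1))
        simp [h0, h1, h2] at this
      · right; right; exact ⟨q', c, rfl, rfl, rfl, by simp [next, h0, h1, h2]⟩
    · right; left; exact ⟨q', c, rfl, rfl, by simp [next, h0, h1]⟩
  · left; exact ⟨q', c, rfl, by simp [next, h0]⟩

theorem next_mono (l : ℕ → M.A) (s : M.Q × ℕ) : s.2 ≤ (next l s).1.2 ∧ (next l s).1.2 ≤ s.2 + 2 := by
  obtain ⟨q, p⟩ := s
  rcases next_cases l q p with ⟨q', c, _, h⟩ | ⟨q', c, _, _, h⟩ | ⟨q', c, _, _, _, h⟩ <;> simp [h]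

theorem next_local (l l' : ℕ → M.A) (s : M.Q × ℕ) (H : ∀ i < (next l s).1.2, l i = l' i) :
    next l' s = next l s := by
  obtain ⟨q, p⟩ := s
  rcases next_cases l q p with ⟨q', c, h0, h⟩ | ⟨q', c, h0, h1, h⟩ | ⟨q', c, h0, h1, h2, h⟩
  · rw [h]; simp [next, h0]
  · rw [h] at H ⊢
    have := H p (by simp)
    simp [next, h0, ← this, h1]
  · rw [h] at H ⊢
    have e1 := H p (by simp)
    have e2 := H (p + 1) (by simp)
    simp [next, h0, ← e1, ← e2, h1, h2]

theorem next_shift (l : ℕ → M.A) (q : M.Q) (p k : ℕ) :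
    next l (q, k + p) =
      (((next (fun i => l (k + i)) (q, p)).1.1, k + (next (fun i => l (k + i)) (q, p)).1.2),
        (next (fun i => l (k + i)) (q, p)).2) := by
  rcases next_cases (fun i => l (k + i)) q p with
    ⟨q', c, h0, h⟩ | ⟨q', c, h0, h1, h⟩ | ⟨q', c, h0, h1, h2, h⟩
  · rw [h]; simp [next, h0]
  · rw [h]; simp [next, h0, h1, Nat.add_assoc]
  · rw [h]; simp [next, h0, h1, h2, Nat.add_assoc]

theorem conf_local (l l' : ℕ → M.A) (q : M.Q) (n : ℕ)
    (H : ∀ i < (conf l q n).2, l i = l' i) : conf l' q n = conf l q n := by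
  induction n with
  | zero => rfl
  | succ n ih =>
    have e := ih fun i hi => H i (lt_of_lt_of_le hi (next_mono l _).1)
    simp only [conf] at H ⊢
    rw [e, next_local l l' _ H]

theorem nx_local (l l' : ℕ → M.A) (q : M.Q) (n : ℕ)
    (H : ∀ i < (conf l q (n + 1)).2, l i = l' i) : nx l' q n = nx l q n := by
  unfold nx
  rw [conf_local l l' q n fun i hi => H i (lt_of_lt_of_le hi (next_mono l _).1)]
  exact next_local l l' _ H

theorem conf_shift (l : ℕ → M.A) (q : M.Q) (n m : ℕ) :
    conf l q (n + m) =
      ((conf (fun i => l ((conf l q n).2 + i)) (conf l q n).1 m).1,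
       (conf l q n).2 + (conf (fun i => l ((conf l q n).2 + i)) (conf l q n).1 m).2) := by
  induction m with
  | zero => simp [conf]
  | succ m ih =>
    rw [← Nat.add_assoc]
    simp only [conf]
    rw [ih, next_shift]

theorem nx_shift (l : ℕ → M.A) (q : M.Q) (n m : ℕ) :
    (nx l q (n + m)).2 = (nx (fun i => l ((conf l q n).2 + i)) (conf l q n).1 m).2 := by
  unfold nx
  rw [conf_shift, next_shift]

/-! ### Queue machine runs -/

def seg (l : ℕ → M.A) (p n : ℕ) : List M.A := (List.range' p (n + 1 - p)).map l

theorem seg_cons (l : ℕ → M.A) {p n : ℕ} (h : p ≤ n) : seg l p n = l p :: seg l (p + 1) n := by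
  unfold seg
  rw [show n + 1 - p = (n + 1 - (p + 1)) + 1 by omega, List.range'_succ]
  simp

theorem seg_nil (l : ℕ → M.A) (n : ℕ) : seg l (n + 1) n = [] := by simp [seg]

theorem seg_snoc (l : ℕ → M.A) {p n : ℕ} (h : p ≤ n + 1) :
    seg l p n ++ [l (n + 1)] = seg l p (n + 1) := by
  unfold seg
  rw [show n + 1 + 1 - p = (n + 1 - p) + 1 by omega, List.range'_concat]
  simp
  congr 1; omega

theorem step_det {a b c : M.Q × List M.A} (h : M.Step a b) (h' : M.Step a c) : b = c := by
  cases h <;> cases h' <;> simp_all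

theorem step_lemma (l : ℕ → M.A) (q : M.Q) {p n : ℕ} (hp : p ≤ n) :
    ((next l (q, p)).1.2 ≤ n + 1 →
      M.Step (q, seg l p n) ((next l (q, p)).1.1, seg l (next l (q, p)).1.2 n ++ [(next l (q, p)).2])) ∧
    (n + 1 < (next l (q, p)).1.2 → M.Stuck (q, seg l p n)) := by
  rcases next_cases l q p with ⟨q', c, h0, h⟩ | ⟨q', c, h0, h1, h⟩ | ⟨q', c, h0, h1, h2, h⟩
  · rw [h]
    exact ⟨fun _ => .step0 h0, fun h => by simp at h; omega⟩
  · rw [h]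
    refine ⟨fun _ => ?_, fun h => by simp at h; omega⟩
    rw [seg_cons l hp]
    exact .step1 h0 h1
  · rw [h]
    refine ⟨fun h' => ?_, fun h' => ?_⟩
    · simp at h'
      rw [seg_cons l hp, seg_cons l h']
      exact .step2 h0 h1 h2
    · simp at h'
      obtain rfl : p = n := by omega
      rw [seg_cons l hp, seg_nil]
      intro c' hs
      generalize hw : (q, [l p]) = w at hs
      cases hs <;> simp_all

structure IsSol (l : ℕ → M.A) : Prop where
  zero : l 0 = M.dollar
  succ : ∀ n, l (n + 1) = (nx l M.q1 n).2
  le : ∀ n, (conf l M.q1 n).2 ≤ n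

theorem IsSol.not_terminates {l : ℕ → M.A} (hl : IsSol l) : ¬ M.Terminates := by
  rintro ⟨cfg, hr, hs⟩
  have key : ∃ n, cfg = ((conf l M.q1 n).1, seg l (conf l M.q1 n).2 n) := by
    clear hs
    induction hr with
    | refl => exact ⟨0, by simp [conf, seg, hl.zero]⟩
    | tail _ hstep ih =>
      obtain ⟨n, rfl⟩ := ih
      refine ⟨n + 1, ?_⟩
      have := (step_lemma l (conf l M.q1 n).1 (hl.le n)).1 (hl.le (n + 1))
      rw [step_det hstep this, ← seg_snoc l (hl.le (n + 1)), hl.succ]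
      rfl
  obtain ⟨n, rfl⟩ := key
  exact hs _ ((step_lemma l (conf l M.q1 n).1 (hl.le n)).1 (hl.le (n + 1)))

theorem IsSol.unique {l l' : ℕ → M.A} (hl : IsSol l) (hl' : IsSol l') : l = l' := by
  funext n
  induction n using Nat.strong_induction_on with
  | _ n ih =>
    cases n with
    | zero => rw [hl.zero, hl'.zero]
    | succ n =>
      rw [hl.succ, hl'.succ, nx_local l l']
      intro i hi
      exact ih i (lt_of_lt_of_le hi (hl.le (n + 1)))

def hist (M : QM) : ℕ → ℕ → M.A
  | 0 => fun _ => M.dollar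
  | n + 1 => Function.update (hist M n) (n + 1) (nx (hist M n) M.q1 n).2

theorem hist_le (m i : ℕ) (h : i ≤ m) : hist M m i = hist M i i := by
  induction m with
  | zero => obtain rfl : i = 0 := by omega
            rfl
  | succ m ih =>
    rcases Nat.lt_or_ge m i with h' | h'
    · obtain rfl : i = m + 1 := by omega
      rfl
    · rw [← ih h', hist, Function.update_of_ne (by omega)]

theorem exists_sol (hM : ¬ M.Terminates) : ∃ l : ℕ → M.A, IsSol l := by
  let l : ℕ → M.A := fun i => hist M i i
  have key : ∀ n, (conf l M.q1 n).2 ≤ n ∧ Relation.ReflTransGen M.Step (M.q1, [M.dollar])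
      ((conf l M.q1 n).1, seg l (conf l M.q1 n).2 n) →
      (conf l M.q1 (n + 1)).2 ≤ n + 1 ∧ l (n + 1) = (nx l M.q1 n).2 := by
    rintro n ⟨h1, h2⟩
    have h3 : (conf l M.q1 (n + 1)).2 ≤ n + 1 := by
      by_contra hc
      exact hM ⟨_, h2, (step_lemma l (conf l M.q1 n).1 h1).2 (by push Not at hc; exact hc)⟩
    refine ⟨h3, ?_⟩
    rw [← nx_local l (hist M n)]
    · simp [l, hist]
    · intro i hi
      exact (hist_le n i (by omega)).symm
  have all : ∀ n, (conf l M.q1 n).2 ≤ n ∧ Relation.ReflTransGen M.Step (M.q1, [M.dollar])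
      ((conf l M.q1 n).1, seg l (conf l M.q1 n).2 n) := by
    intro n
    induction n with
    | zero => exact ⟨le_rfl, by simp [conf, seg, l, hist]; exact .refl⟩
    | succ n ih =>
      obtain ⟨h3, h4⟩ := key n ih
      refine ⟨h3, ih.2.tail ?_⟩
      have := (step_lemma l (conf l M.q1 n).1 ih.1).1 h3
      rw [← seg_snoc l h3, h4]
      exact this
  exact ⟨l, rfl, fun n => (key n (all n)).2, fun n => (all n).1⟩

/-! ### Terms and the action of states on streams -/

theorem ar_none (ts : Fin (M.ar none) → α) : ts = Fin.elim0 := by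
  funext i; exact Fin.elim0 (show Fin 0 from i)

theorem term_ind {X : Type} {P : Term M.Op M.ar X → Prop} (hv : ∀ x, P (.var x))
    (hC : P (M.CT X)) (hq : ∀ q t, P t → P (M.qT q t)) : ∀ t, P t := by
  intro t
  induction t with
  | var x => exact hv x
  | op o ts ih =>
    cases o with
    | none => rw [ar_none ts]; exact hC
    | some q =>
      have : ts = fun _ => ts (0 : Fin 1) := by
        funext i; exact congrArg ts (Subsingleton.elim (α := Fin 1) i 0)
      rw [this]
      exact hq q _ (ih _)

theorem map_CT {X Y : Type} (f : X → Y) : (M.CT X).map f = M.CT Y := by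
  exact congrArg (Term.op (none : M.Op)) (ar_none _)

theorem map_qT {X Y : Type} (f : X → Y) (q : M.Q) (t : Term M.Op M.ar X) :
    (M.qT q t).map f = M.qT q (t.map f) := rfl

theorem join_CT {X : Type} : (M.CT (Term M.Op M.ar X)).join = M.CT X := by
  exact congrArg (Term.op (none : M.Op)) (ar_none _)

theorem join_qT {X : Type} (q : M.Q) (t : Term M.Op M.ar (Term M.Op M.ar X)) :
    (M.qT q t).join = M.qT q t.join := rfl

def size {X : Type} : Term M.Op M.ar X → ℕ
  | .var _ => 0
  | .op _ ts => 1 + ∑ i, size (ts i)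

theorem qT_ne {X : Type} (q : M.Q) (t : Term M.Op M.ar X) : t ≠ M.qT q t := by
  intro h
  have h' := congrArg size h
  have : size (M.qT q t) = 1 + size t := by
    simp only [QM.qT, size]
    change 1 + ∑ i : Fin 1, size t = _
    simp
  omega

abbrev lab {X A : Type} (τ : Stream' (X × A)) : ℕ → A := fun i => (τ i).2

def act {X : Type} (q : M.Q) (τ : Stream' (Term M.Op M.ar X × M.A)) :
    Stream' (Term M.Op M.ar X × M.A) :=
  fun n => (M.qT (conf (lab τ) q n).1 (τ (conf (lab τ) q n).2).1, (nx (lab τ) q n).2)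

theorem act_map {X Y : Type} (g : Term M.Op M.ar X → Term M.Op M.ar Y)
    (hg : ∀ q t, g (M.qT q t) = M.qT q (g t)) (q : M.Q)
    (τ : Stream' (Term M.Op M.ar X × M.A)) :
    act q (Stream'.map (Prod.map g id) τ) = Stream'.map (Prod.map g id) (act q τ) := by
  funext n
  change (_, _) = (g _, _)
  rw [hg]
  rfl

theorem act_drop {X : Type} (q : M.Q) (τ : Stream' (Term M.Op M.ar X × M.A)) (n : ℕ) :
    (act q τ).drop n = act (conf (lab τ) q n).1 (τ.drop (conf (lab τ) q n).2) := by
  have hl : lab (τ.drop (conf (lab τ) q n).2) = fun i => lab τ ((conf (lab τ) q n).2 + i) := by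
    funext i; change (τ _).2 = (τ _).2; rw [Nat.add_comm]
  funext m
  change act q τ (m + n) = _
  unfold act
  rw [hl, Nat.add_comm m n, conf_shift, nx_shift]
  congr 2
  change (τ _).1 = (τ _).1
  rw [Nat.add_comm]

/-- States of the behaviour of the constant. -/
def cst (X : Type) (f : ℕ → M.Q × ℕ) : ℕ → Term M.Op M.ar X
  | 0 => M.CT X
  | n + 1 => M.qT (f n).1 (cst X f (min (f n).2 n))
  decreasing_by omega

def cstr (X : Type) (l : ℕ → M.A) : Stream' (Term M.Op M.ar X × M.A) :=
  fun n => (cst X (conf l M.q1) n, l n)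

theorem cst_map {X Y : Type} (g : Term M.Op M.ar X → Term M.Op M.ar Y)
    (hC : g (M.CT X) = M.CT Y)
    (hg : ∀ q t, g (M.qT q t) = M.qT q (g t)) (f : ℕ → M.Q × ℕ) (n : ℕ) :
    g (cst X f n) = cst Y f n := by
  induction n using Nat.strong_induction_on with
  | _ n ih =>
    cases n with
    | zero => rw [cst, cst, hC]
    | succ n => rw [cst, cst, hg, ih _ (by omega)]

theorem cstr_map {X Y : Type} (g : Term M.Op M.ar X → Term M.Op M.ar Y)
    (hC : g (M.CT X) = M.CT Y)
    (hg : ∀ q t, g (M.qT q t) = M.qT q (g t)) (l : ℕ → M.A) :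
    cstr Y l = Stream'.map (Prod.map g id) (cstr X l) := by
  funext n
  change (_, _) = (g _, _)
  rw [cst_map g hC hg]
  rfl

theorem cstr_zero (X : Type) {l : ℕ → M.A} (hl : IsSol l) : cstr X l 0 = (M.CT X, M.dollar) := by
  simp [cstr, cst, hl.zero]

theorem cstr_succ (X : Type) {l : ℕ → M.A} (hl : IsSol l) (n : ℕ) :
    cstr X l (n + 1) = act M.q1 (cstr X l) n := by
  have : lab (cstr X l) = l := rfl
  unfold act
  rw [this]
  simp only [cstr]
  rw [cst, hl.succ, min_eq_left (hl.le n)]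

/-- Any stream solving the defining equation of the constant is the canonical one. -/
theorem sol_of_stream {X : Type} (s : Stream' (Term M.Op M.ar X × M.A))
    (h0 : s 0 = (M.CT X, M.dollar)) (hs : ∀ n, s (n + 1) = act M.q1 s n) :
    IsSol (lab s) ∧ s = cstr X (lab s) := by
  have hsol : IsSol (lab s) := by
    refine ⟨by simp [lab, h0], fun n => by simp only [lab]; rw [hs]; rfl, fun n => ?_⟩
    induction n with
    | zero => exact le_rfl
    | succ n ih =>
      have hne : (conf (lab s) M.q1 (n + 1)).2 ≠ n + 1 + 1 := by
        intro hc
        have := congrArg Prod.fst (hs (n + 1))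
        simp only [act] at this
        rw [hc] at this
        exact qT_ne _ _ this
      have := (next_mono (lab s) (conf (lab s) M.q1 n)).2
      change (conf (lab s) M.q1 (n + 1)).2 ≤ _ at this
      omega
  refine ⟨hsol, ?_⟩
  funext n
  refine Prod.ext ?_ rfl
  induction n using Nat.strong_induction_on with
  | _ n ih =>
    cases n with
    | zero => rw [cstr_zero X hsol, h0]
    | succ n =>
      rw [hs, cstr_succ X hsol]
      change M.qT _ _ = M.qT _ _
      rw [ih _ (Nat.lt_succ_of_le (hsol.le n))]
      rfl

/-! ### The canonical law -/

def comb {X : Type} (l : ℕ → M.A) : (o : M.Op) →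
    (Fin (M.ar o) → Stream' (Term M.Op M.ar X × M.A)) → Stream' (Term M.Op M.ar X × M.A)
  | none, _ => cstr X l
  | some q, ts => act q (ts (0 : Fin 1))

def theLaw (l : ℕ → M.A) (X : Type) :
    Term M.Op M.ar (Stream' (X × M.A)) → Stream' (Term M.Op M.ar X × M.A)
  | .var σ => Stream'.map (Prod.map Term.var id) σ
  | .op o ts => comb l o fun i => theLaw l X (ts i)

theorem theLaw_CT (l : ℕ → M.A) (X : Type) : theLaw l X (M.CT _) = cstr X l := rfl

theorem theLaw_qT (l : ℕ → M.A) (X : Type) (q : M.Q) (t) :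
    theLaw l X (M.qT q t) = act q (theLaw l X t) := rfl

theorem theLaw_cst {l : ℕ → M.A} (hl : IsSol l) (X : Type) (n : ℕ) :
    theLaw l X (cst _ (conf l M.q1) n) = (cstr X l).drop n := by
  induction n using Nat.strong_induction_on with
  | _ n ih =>
    cases n with
    | zero => rw [cst, theLaw_CT]; rfl
    | succ n =>
      rw [cst, theLaw_qT, min_eq_left (hl.le n), ih _ (Nat.lt_succ_of_le (hl.le n))]
      have := act_drop M.q1 (cstr X l) n
      change _ = act (conf l M.q1 n).1 ((cstr X l).drop (conf l M.q1 n).2) at this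
      rw [← this]
      funext m
      exact (cstr_succ X hl (m + n)).symm

theorem theLaw_comult {l : ℕ → M.A} (hl : IsSol l) (X : Type)
    (u : Term M.Op M.ar (Stream' (X × M.A))) :
    Stream'.map (Prod.map (theLaw l X) id) (theLaw l (Stream' (X × M.A)) (u.map sTails)) =
        sTails (theLaw l X u) := by
  induction u using term_ind with
  | hv σ => rfl
  | hC =>
    rw [map_CT, theLaw_CT, theLaw_CT]
    funext n
    refine Prod.ext ?_ rfl
    exact theLaw_cst hl X n
  | hq q t ih =>
    rw [map_qT, theLaw_qT, theLaw_qT]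
    generalize theLaw l (Stream' (X × M.A)) (t.map sTails) = τ' at *
    generalize theLaw l X t = τ at *
    have hlab : lab τ' = lab τ := by
      funext i
      exact congrArg Prod.snd (congrFun ih i)
    have hst : ∀ i, theLaw l X (τ' i).1 = τ.drop i := fun i =>
      congrArg Prod.fst (congrFun ih i)
    funext n
    refine Prod.ext ?_ ?_
    · change theLaw l X (M.qT _ _) = (act q τ).drop n
      rw [act_drop, theLaw_qT, hst, hlab]
    · change (nx (lab τ') q n).2 = (nx (lab τ) q n).2
      rw [hlab]

def canon (l : ℕ → M.A) (hl : IsSol l) : DistLaw M.Op M.ar M.A where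
  law := theLaw l
  natural X Y f u := by
    induction u using term_ind with
    | hv σ => rfl
    | hC =>
      rw [map_CT, theLaw_CT, theLaw_CT]
      exact cstr_map _ (map_CT f) (map_qT f) l
    | hq q t ih =>
      rw [map_qT, theLaw_qT, theLaw_qT, ih]
      exact act_map _ (map_qT f) q _
  ax_unit X σ := rfl
  ax_counit X u := by
    induction u using term_ind with
    | hv σ => rfl
    | hC =>
      rw [map_CT, theLaw_CT, cstr_zero X hl]
    | hq q t ih =>
      rw [map_qT, theLaw_qT, ← ih]
      rfl
  ax_mult X u := by
    induction u using term_ind with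
    | hv t => rfl
    | hC =>
      rw [map_CT, join_CT, theLaw_CT, theLaw_CT]
      exact cstr_map _ join_CT join_qT l
    | hq q t ih =>
      rw [map_qT, join_qT, theLaw_qT, theLaw_qT, ih]
      exact act_map _ join_qT q _
  ax_comult := theLaw_comult hl

theorem canon_extends (l : ℕ → M.A) (hl : IsSol l) : M.ExtendsRho (canon l hl) := by
  have hq : ∀ (X : Type) (q : M.Q) (σ : Stream' (X × M.A)),
      firstTrans ((canon l hl).law X (M.qT q (Term.var σ))) =
        ((next (lab σ) (q, 0)).2, M.qT (next (lab σ) (q, 0)).1.1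
          (Term.var (σ (next (lab σ) (q, 0)).1.2).1)) := fun X q σ => rfl
  refine ⟨fun X => ?_, fun X q σ q' c h0 => ?_, fun X q σ q' c h0 h1 => ?_,
    fun X q σ q' c h0 h1 h2 => ?_⟩
  · change ((cstr X l 0).2, (cstr X l 1).1) = _
    rw [cstr_zero X hl, cstr_succ X hl 0]
    change (M.dollar, M.qT M.q1 (cstr X l 0).1) = _
    rw [cstr_zero X hl]
  · rw [hq]; simp [next, h0]
  · rw [hq]; simp [next, h0, h1]
  · rw [hq]; simp [next, h0, h1, h2]

/-! ### Analysis of an arbitrary extension -/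

section
variable {lam : DistLaw M.Op M.ar M.A} (h : M.ExtendsRho lam)

theorem ext_first (h : M.ExtendsRho lam) (X : Type) (q : M.Q) (σ : Stream' (X × M.A)) :
    firstTrans (lam.law X (M.qT q (Term.var σ))) =
        ((next (lab σ) (q, 0)).2, M.qT (next (lab σ) (q, 0)).1.1
          (Term.var (σ (next (lab σ) (q, 0)).1.2).1)) := by
  obtain ⟨-, e0, e1, e2⟩ := h
  rcases next_cases (lab σ) q 0 with ⟨q', c, h0, h⟩ | ⟨q', c, h0, h1, h⟩ | ⟨q', c, h0, h1, h2, h⟩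
  · rw [h, e0 X q σ q' c h0]
  · rw [h, e1 X q σ q' c h0 h1]
  · rw [h, e2 X q σ q' c h0 h1 h2]

theorem law_drop (X : Type) (u : Term M.Op M.ar (Stream' (X × M.A))) (n : ℕ) :
    lam.law X (lam.law (Stream' (X × M.A)) (u.map sTails) n).1 = (lam.law X u).drop n :=
  congrArg Prod.fst (congrFun (lam.ax_comult X u) n)

theorem ext_trans (h : M.ExtendsRho lam) (n : ℕ) : ∀ (X : Type) (q : M.Q) (σ : Stream' (X × M.A)),
    (lam.law X (M.qT q (Term.var σ)) n).1 =
      M.qT (conf (lab σ) q n).1 (Term.var (σ (conf (lab σ) q n).2).1) ∧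
    (lam.law X (M.qT q (Term.var σ)) n).2 = (nx (lab σ) q n).2 := by
  have main : ∀ n, (∀ (X : Type) (q : M.Q) (σ : Stream' (X × M.A)),
    (lam.law X (M.qT q (Term.var σ)) n).1 =
      M.qT (conf (lab σ) q n).1 (Term.var (σ (conf (lab σ) q n).2).1)) →
    (∀ (X : Type) (q : M.Q) (σ : Stream' (X × M.A)),
    (lam.law X (M.qT q (Term.var σ)) (n + 1)).1 =
      M.qT (conf (lab σ) q (n + 1)).1 (Term.var (σ (conf (lab σ) q (n + 1)).2).1) ∧
    (lam.law X (M.qT q (Term.var σ)) n).2 = (nx (lab σ) q n).2) := by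
    intro n ih X q σ
    have hd := law_drop (lam := lam) X (M.qT q (Term.var σ)) n
    have e := ih (Stream' (X × M.A)) q (sTails σ)
    change (lam.law _ ((M.qT q (Term.var σ)).map sTails) n).1 =
      M.qT (conf (lab σ) q n).1 (Term.var (σ.drop (conf (lab σ) q n).2)) at e
    rw [e] at hd
    have hf := ext_first h X (conf (lab σ) q n).1 (σ.drop (conf (lab σ) q n).2)
    rw [hd] at hf
    have hl : lab (σ.drop (conf (lab σ) q n).2) =
        fun i => lab σ ((conf (lab σ) q n).2 + i) := by
      funext i; change (σ _).2 = (σ _).2; rw [Nat.add_comm]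
    rw [hl] at hf
    have hsh := next_shift (lab σ) (conf (lab σ) q n).1 0 (conf (lab σ) q n).2
    have a1 := congrArg Prod.fst hf
    have a2 := congrArg Prod.snd hf
    simp only [firstTrans] at a1 a2
    change (lam.law X (M.qT q (Term.var σ)) (0 + n)).2 = _ at a1
    change (lam.law X (M.qT q (Term.var σ)) (1 + n)).1 = 
      M.qT _ (Term.var (σ (_ + _)).1) at a2
    rw [Nat.zero_add] at a1
    rw [Nat.add_comm 1 n, Nat.add_comm _ (conf (lab σ) q n).2] at a2
    change nx (lab σ) q n = _ at hsh
    rw [conf_succ, hsh]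
    exact ⟨a2, a1⟩
  have st : ∀ n, (∀ (X : Type) (q : M.Q) (σ : Stream' (X × M.A)),
    (lam.law X (M.qT q (Term.var σ)) n).1 =
      M.qT (conf (lab σ) q n).1 (Term.var (σ (conf (lab σ) q n).2).1)) := by
    intro n
    induction n with
    | zero => intro X q σ; rw [lam.ax_counit]; rfl
    | succ n ih => exact fun X q σ => (main n ih X q σ).1
  exact fun X q σ => ⟨st n X q σ, (main n (st n) X q σ).2⟩

theorem ext_qT (h : M.ExtendsRho lam) (X : Type) (q : M.Q)
    (t : Term M.Op M.ar (Stream' (X × M.A))) :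
    lam.law X (M.qT q t) = act q (lam.law X t) := by
  have e := lam.ax_mult X (M.qT q (Term.var t))
  change lam.law X (M.qT q t) = Stream'.map (Prod.map Term.join id)
    (lam.law _ (M.qT q (Term.var (lam.law X t)))) at e
  rw [e]
  funext n
  obtain ⟨e1, e2⟩ := ext_trans h n _ q (lam.law X t)
  refine Prod.ext ?_ e2
  change Term.join (lam.law _ (M.qT q (Term.var (lam.law X t))) n).1 = _
  rw [e1]
  rfl

theorem ext_CT (h : M.ExtendsRho lam) (X : Type) :
    IsSol (lab (lam.law X (M.CT _))) ∧
      lam.law X (M.CT _) = cstr X (lab (lam.law X (M.CT _))) := by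
  apply sol_of_stream
  · refine Prod.ext ?_ (congrArg Prod.fst (h.1 X))
    rw [lam.ax_counit, map_CT]
  · intro n
    have hd := law_drop (lam := lam) X (M.CT _) 1
    have e := congrArg Prod.snd (h.1 (Stream' (X × M.A)))
    simp only [firstTrans] at e
    rw [map_CT, e, ext_qT h] at hd
    rw [hd]
    rfl

theorem ext_law (h : M.ExtendsRho lam) {l : ℕ → M.A} (hl : IsSol l) : lam.law = theLaw l := by
  funext X u
  induction u using term_ind with
  | hv σ => exact lam.ax_unit X σ
  | hC =>
    obtain ⟨h1, h2⟩ := ext_CT h X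
    rw [h2, h1.unique hl, theLaw_CT]
  | hq q t ih => rw [ext_qT h, ih, theLaw_qT]

end

theorem not_terminates_of_ext {lam : DistLaw M.Op M.ar M.A} (h : M.ExtendsRho lam) :
    ¬ M.Terminates := (ext_CT h Empty).1.not_terminates

theorem distLaw_ext {Op : Type} {ar : Op → ℕ} {A : Type} {a b : DistLaw Op ar A}
    (h : a.law = b.law) : a = b := by
  cases a; cases b; cases h; rfl

end QMP

/-- A queue machine's induced stream biGSOS law `ρ_M` extends to exactly one
distributive law iff `M` does not terminate from the initial configuration `(q1, $)`;
moreover, if `M` terminates, then `ρ_M` extends to no distributive law at all. -/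
theorem unique_distLaw_iff_not_terminates (M : QM) :
    ((∃! lam : DistLaw M.Op M.ar M.A, M.ExtendsRho lam) ↔ ¬ M.Terminates) ∧
    (M.Terminates → ¬ ∃ lam : DistLaw M.Op M.ar M.A, M.ExtendsRho lam) := by
  refine ⟨⟨?_, ?_⟩, ?_⟩
  · rintro ⟨lam, h, -⟩
    exact QMP.not_terminates_of_ext h
  · intro hM
    obtain ⟨l, hl⟩ := QMP.exists_sol hM
    refine ⟨QMP.canon l hl, QMP.canon_extends l hl, fun lam h => ?_⟩
    exact QMP.distLaw_ext (QMP.ext_law h hl)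
  · rintro ht ⟨lam, h⟩
    exact QMP.not_terminates_of_ext h ht
end

section
/- For the case of stream systems (B X = A × X), it is undecidable whether a given mixed-GSOS specification extends to a unique distributive law. Concretely: under any natural encoding of queue machines as natural numbers (say with states and alphabet letters given as initial segments of the natural numbers), the predicate on queue machines M given by 'the induced stream biGSOS law ρ_M extends to exactly one distributive law' is not a computable (decidable) predicate. -/
/-- A concrete, naturally encodable representation of a queue machine: states are
`0, ..., nQ-1` and letters are `0, ..., nA-1` (initial segments of ℕ), and the
partial transition functions `δ0, δ1, δ2` are given by (flattened) tables. -/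
structure QMTable where
  nQ : ℕ
  nA : ℕ
  dollar : ℕ
  q1 : ℕ
  t0 : List (Option (ℕ × ℕ))
  t1 : List (Option (ℕ × ℕ))
  t2 : List (Option (ℕ × ℕ))

def qmTableEquiv :
    QMTable ≃ ℕ × ℕ × ℕ × ℕ × List (Option (ℕ × ℕ)) × List (Option (ℕ × ℕ)) × List (Option (ℕ × ℕ)) where
  toFun T := (T.nQ, T.nA, T.dollar, T.q1, T.t0, T.t1, T.t2)
  invFun p := ⟨p.1, p.2.1, p.2.2.1, p.2.2.2.1, p.2.2.2.2.1, p.2.2.2.2.2.1, p.2.2.2.2.2.2⟩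
  left_inv T := rfl
  right_inv p := rfl

/-- The natural encoding of queue machines as natural numbers. -/
instance : Primcodable QMTable := Primcodable.ofEquiv _ qmTableEquiv

/-- `δ0` of the encoded machine. -/
def QMTable.d0 (T : QMTable) (q : ℕ) : Option (ℕ × ℕ) := T.t0.getD q none
/-- `δ1` of the encoded machine. -/
def QMTable.d1 (T : QMTable) (q a : ℕ) : Option (ℕ × ℕ) := T.t1.getD (q * T.nA + a) none
/-- `δ2` of the encoded machine. -/
def QMTable.d2 (T : QMTable) (q a b : ℕ) : Option (ℕ × ℕ) :=
  T.t2.getD ((q * T.nA + a) * T.nA + b) none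

/-- The table is a well-formed queue machine: everything in range, and the three
partial transition functions are disjointly defined and jointly total. -/
structure QMTable.Valid (T : QMTable) : Prop where
  hQ : 0 < T.nQ
  hA : 0 < T.nA
  hdollar : T.dollar < T.nA
  hq1 : T.q1 < T.nQ
  range0 : ∀ q < T.nQ, ∀ p ∈ T.d0 q, p.1 < T.nQ ∧ p.2 < T.nA
  range1 : ∀ q < T.nQ, ∀ a < T.nA, ∀ p ∈ T.d1 q a, p.1 < T.nQ ∧ p.2 < T.nA
  range2 : ∀ q < T.nQ, ∀ a < T.nA, ∀ b < T.nA, ∀ p ∈ T.d2 q a b, p.1 < T.nQ ∧ p.2 < T.nA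
  exactOne : ∀ q < T.nQ, ∀ a < T.nA, ∀ b < T.nA,
      ((T.d0 q).isSome ∧ T.d1 q a = none ∧ T.d2 q a b = none) ∨
      (T.d0 q = none ∧ (T.d1 q a).isSome ∧ T.d2 q a b = none) ∨
      (T.d0 q = none ∧ T.d1 q a = none ∧ (T.d2 q a b).isSome)

/-- The step relation on configurations `(q, w)`. -/
inductive QMTable.Step (T : QMTable) : ℕ × List ℕ → ℕ × List ℕ → Prop
  | step0 {q w q' c} : T.d0 q = some (q', c) → QMTable.Step T (q, w) (q', w ++ [c])
  | step1 {q a w q' c} : T.d0 q = none → T.d1 q a = some (q', c) →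
      QMTable.Step T (q, a :: w) (q', w ++ [c])
  | step2 {q a b w q' c} : T.d0 q = none → T.d1 q a = none → T.d2 q a b = some (q', c) →
      QMTable.Step T (q, a :: b :: w) (q', w ++ [c])

/-- `T` terminates from the initial configuration `(q1, [$])`. -/
def QMTable.Terminates (T : QMTable) : Prop :=
  ∃ cfg, Relation.ReflTransGen T.Step (T.q1, [T.dollar]) cfg ∧ ∀ c', ¬ T.Step cfg c'

/-- The signature induced by an encoded queue machine: one constant `C` and a unary
operation symbol for every state `q ∈ Fin nQ`. -/
def QMTable.sig (T : QMTable) : Option (Fin T.nQ) → ℕ := fun o => o.elim 0 fun _ => 1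

/-- The constant term `C`. -/
def QMTable.CT (T : QMTable) (X : Type) : Term (Option (Fin T.nQ)) T.sig X :=
  Term.op none Fin.elim0

/-- Application of the unary operation symbol `q`. -/
def QMTable.qTm (T : QMTable) {X : Type} (q : Fin T.nQ)
    (t : Term (Option (Fin T.nQ)) T.sig X) : Term (Option (Fin T.nQ)) T.sig X :=
  Term.op (some q) fun _ => t

/-- A distributive law `λ` extends the biGSOS law `ρ_T` induced by the (valid) encoded
queue machine `T`: the first transition of `λ_X(ι(t))` is as prescribed by the rules
`C →$ q1(C)`; `q(x0 →a0 ⋯) →c q'(x0)` if `δ0(q) = (q', c)`;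
`q(x0 →a0 x1 →a1 ⋯) →c q'(x1)` if `δ0(q)` is undefined and `δ1(q, a0) = (q', c)`;
`q(x0 →a0 x1 →a1 x2 →a2 ⋯) →c q'(x2)` if `δ0(q), δ1(q, a0)` are undefined and
`δ2(q, a0, a1) = (q', c)`. -/
def QMTable.ExtendsRho (T : QMTable) (hV : T.Valid)
    (lam : DistLaw (Option (Fin T.nQ)) T.sig (Fin T.nA)) : Prop :=
  (∀ X : Type,
    firstTrans (lam.law X (T.CT (Stream' (X × Fin T.nA)))) =
      ((⟨T.dollar, hV.hdollar⟩ : Fin T.nA), T.qTm ⟨T.q1, hV.hq1⟩ (T.CT X))) ∧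
  (∀ (X : Type) (q : Fin T.nQ) (σ : Stream' (X × Fin T.nA)) (q' : Fin T.nQ) (c : Fin T.nA),
    T.d0 q.val = some (q'.val, c.val) →
    firstTrans (lam.law X (T.qTm q (Term.var σ))) = (c, T.qTm q' (Term.var (σ 0).1))) ∧
  (∀ (X : Type) (q : Fin T.nQ) (σ : Stream' (X × Fin T.nA)) (q' : Fin T.nQ) (c : Fin T.nA),
    T.d0 q.val = none → T.d1 q.val ((σ 0).2).val = some (q'.val, c.val) →
    firstTrans (lam.law X (T.qTm q (Term.var σ))) = (c, T.qTm q' (Term.var (σ 1).1))) ∧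
  (∀ (X : Type) (q : Fin T.nQ) (σ : Stream' (X × Fin T.nA)) (q' : Fin T.nQ) (c : Fin T.nA),
    T.d0 q.val = none → T.d1 q.val ((σ 0).2).val = none →
    T.d2 q.val ((σ 0).2).val ((σ 1).2).val = some (q'.val, c.val) →
    firstTrans (lam.law X (T.qTm q (Term.var σ))) = (c, T.qTm q' (Term.var (σ 2).1)))


/-! ### Abstract queue machines -/

/-- An abstract queue machine. -/
structure AQM (Q A : Type) where
  d0 : Q → Option (Q × A)
  d1 : Q → A → Option (Q × A)
  d2 : Q → A → A → Q × A

namespace AQM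
variable {Q A : Type} (M : AQM Q A)

/-- Next state, output letter and number of consumed letters. -/
def rule (q : Q) (a b : A) : (Q × A) × ℕ :=
  match M.d0 q with
  | some r => (r, 0)
  | none => match M.d1 q a with
    | some r => (r, 1)
    | none => (M.d2 q a b, 2)

/-- One step on configurations. -/
def step : Q × List A → Option (Q × List A)
  | (q, w) => match M.d0 q with
    | some r => some (r.1, w ++ [r.2])
    | none => match w with
      | [] => none
      | a :: w => match M.d1 q a with
        | some r => some (r.1, w ++ [r.2])
        | none => match w with
          | [] => none
          | b :: w => some ((M.d2 q a b).1, w ++ [(M.d2 q a b).2])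

/-- State and read position after `n` steps, reading the letters `c`. -/
def trace (c : ℕ → A) (q : Q) : ℕ → Q × ℕ
  | 0 => (q, 0)
  | n + 1 =>
    let s := trace c q n
    ((M.rule s.1 (c s.2) (c (s.2 + 1))).1.1, s.2 + (M.rule s.1 (c s.2) (c (s.2 + 1))).2)

/-- `n`-th output letter. -/
def out (c : ℕ → A) (q : Q) (n : ℕ) : A :=
  (M.rule (M.trace c q n).1 (c (M.trace c q n).2) (c ((M.trace c q n).2 + 1))).1.2

theorem trace_add (c : ℕ → A) (q : Q) (n m : ℕ) :
    M.trace c q (n + m) =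
      ((M.trace (fun i => c ((M.trace c q n).2 + i)) (M.trace c q n).1 m).1,
        (M.trace c q n).2 + (M.trace (fun i => c ((M.trace c q n).2 + i)) (M.trace c q n).1 m).2) := by
  induction m with
  | zero => rfl
  | succ m ih =>
    rw [← Nat.add_assoc]
    simp only [trace]
    rw [ih]
    simp [Nat.add_assoc]

theorem out_add (c : ℕ → A) (q : Q) (n m : ℕ) :
    M.out c q (n + m) =
      M.out (fun i => c ((M.trace c q n).2 + i)) (M.trace c q n).1 m := by
  simp only [out]
  rw [trace_add]
  simp [Nat.add_assoc]

/-- The run from `(q, [d])`. -/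
def run (q : Q) (d : A) : ℕ → Option (Q × List A)
  | 0 => some (q, [d])
  | n + 1 => (run q d n).bind M.step

/-- The queue content is the segment of `c` from the read position up to `n`. -/
def Inv (c : ℕ → A) (q : Q) (n : ℕ) (cfg : Q × List A) : Prop :=
  cfg.1 = (M.trace c q n).1 ∧ cfg.2 ≠ [] ∧ (M.trace c q n).2 + cfg.2.length = n + 1 ∧
    ∀ i (h : i < cfg.2.length), cfg.2[i] = c ((M.trace c q n).2 + i)

theorem inv_step {c : ℕ → A} {q : Q} {n : ℕ} {cfg cfg' : Q × List A}
    (h : M.Inv c q n cfg) (hs : M.step cfg = some cfg') :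
    cfg'.2.getLast? = some (M.out c q n) ∧
      (c (n + 1) = M.out c q n → M.Inv c q (n + 1) cfg') := by
  obtain ⟨s, w⟩ := cfg
  obtain ⟨h1, h2, h3, h4⟩ := h
  simp only at h1 h2 h3 h4
  subst h1
  simp only [step] at hs
  unfold Inv
  simp only [out, trace, rule]
  generalize hp : M.trace c q n = st at *
  obtain ⟨s, p⟩ := st
  simp only at *
  cases hd0 : M.d0 s with
  | some r =>
    simp only [hd0, Option.some.injEq] at hs ⊢
    subst hs
    refine ⟨by simp, fun hc => ⟨rfl, by simp, by simp; omega, ?_⟩⟩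
    intro i hi
    simp only [List.length_append, List.length_singleton] at hi
    rcases Nat.lt_or_ge i w.length with hlt | hge
    · simp [List.getElem_append_left hlt, h4 i hlt]
    · have : i = w.length := by omega
      subst this
      simp only [List.getElem_concat_length]
      rw [← hc]; congr 1; omega
  | none =>
    simp only [hd0] at hs ⊢
    cases w with
    | nil => simp at h2
    | cons a w =>
      have ha : c p = a := (h4 0 (by simp)).symm
      simp only [ha] at hs ⊢
      cases hd1 : M.d1 s a with
      | some r =>
        simp only [hd1, Option.some.injEq] at hs ⊢
        subst hs
        simp only [List.length_cons] at h3
        refine ⟨by simp, fun hc => ⟨rfl, by simp, by simp; omega, ?_⟩⟩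
        intro i hi
        simp only [List.length_append, List.length_singleton] at hi
        rcases Nat.lt_or_ge i w.length with hlt | hge
        · have := h4 (i+1) (by simp; omega)
          simp only [List.getElem_cons_succ] at this
          simp only [List.getElem_append_left hlt, this]
          congr 1; omega
        · have : i = w.length := by omega
          subst this
          simp only [List.getElem_concat_length]
          rw [← hc]; congr 1; omega
      | none =>
        simp only [hd1] at hs ⊢
        cases w with
        | nil => simp at hs
        | cons b w =>
          have hb : c (p + 1) = b := (h4 1 (by simp)).symm
          simp only [hb, Option.some.injEq] at hs ⊢
          subst hs
          simp only [List.length_cons] at h3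
          refine ⟨by simp, fun hc => ⟨rfl, by simp, by simp; omega, ?_⟩⟩
          intro i hi
          simp only [List.length_append, List.length_singleton] at hi
          rcases Nat.lt_or_ge i w.length with hlt | hge
          · have := h4 (i+2) (by simp; omega)
            simp only [List.getElem_cons_succ] at this
            simp only [List.getElem_append_left hlt, this]
            congr 1; omega
          · have : i = w.length := by omega
            subst this
            simp only [List.getElem_concat_length]
            rw [← hc]; congr 1; omega

theorem inv_zero {c : ℕ → A} {q : Q} {d : A} (h : c 0 = d) : M.Inv c q 0 (q, [d]) := by
  refine ⟨rfl, by simp, rfl, ?_⟩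
  intro i hi
  simp at hi
  subst hi
  simp [trace, h]

/-- Solutions of the stream equation for `C`. -/
def Sol (q : Q) (d : A) (c : ℕ → A) : Prop := c 0 = d ∧ ∀ n, c (n + 1) = M.out c q n

theorem Sol.inv {q : Q} {d : A} {c : ℕ → A} (h : M.Sol q d c) :
    ∀ n cfg, M.run q d n = some cfg → M.Inv c q n cfg := by
  intro n
  induction n with
  | zero =>
    intro cfg hc
    simp only [run, Option.some.injEq] at hc
    subst hc
    exact M.inv_zero h.1
  | succ n ih =>
    intro cfg hc
    simp only [run, Option.bind_eq_some_iff] at hc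
    obtain ⟨cfg0, h0, h1⟩ := hc
    exact (M.inv_step (ih _ h0) h1).2 (h.2 n)

theorem Sol.unique {q : Q} {d : A} {c c' : ℕ → A} (h : M.Sol q d c) (h' : M.Sol q d c')
    (hr : ∀ n, (M.run q d n).isSome) : c = c' := by
  funext n
  cases n with
  | zero => rw [h.1, h'.1]
  | succ n =>
    obtain ⟨cfg1, h1⟩ := Option.isSome_iff_exists.1 (hr (n+1))
    have h2 := h1
    simp only [run, Option.bind_eq_some_iff] at h2
    obtain ⟨cfg0, h0, h2⟩ := h2
    have e1 := (M.inv_step (h.inv M n _ h0) h2).1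
    have e2 := (M.inv_step (h'.inv M n _ h0) h2).1
    rw [h.2, h'.2]
    rw [e1] at e2
    exact Option.some.inj e2

theorem Sol.exists {q : Q} {d : A} (hr : ∀ n, (M.run q d n).isSome) : ∃ c, M.Sol q d c := by
  let c : ℕ → A := fun n => (((M.run q d n).bind (fun x => x.2.getLast?)).getD d)
  have key : ∀ n cfg, M.run q d n = some cfg → M.Inv c q n cfg ∧ c (n+1) = M.out c q n := by
    intro n
    have aux : ∀ n cfg, M.run q d n = some cfg → M.Inv c q n cfg → c (n+1) = M.out c q n := by
      intro n cfg hc hi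
      obtain ⟨cfg1, h1⟩ := Option.isSome_iff_exists.1 (hr (n+1))
      have h2 := h1
      simp only [run, hc, Option.bind_some] at h2
      have e1 := (M.inv_step hi h2).1
      show ((M.run q d (n+1)).bind (fun x => x.2.getLast?)).getD d = _
      rw [h1, Option.bind_some, e1]; rfl
    induction n with
    | zero =>
      intro cfg hc
      have : M.Inv c q 0 cfg := by
        simp only [run, Option.some.injEq] at hc
        subst hc
        exact M.inv_zero rfl
      exact ⟨this, aux _ _ hc this⟩
    | succ n ih =>
      intro cfg hc
      have hc' := hc
      simp only [run, Option.bind_eq_some_iff] at hc'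
      obtain ⟨cfg0, h0, h1⟩ := hc'
      obtain ⟨i0, i1⟩ := ih _ h0
      have := (M.inv_step i0 h1).2 i1
      exact ⟨this, aux _ _ hc this⟩
  refine ⟨c, rfl, fun n => ?_⟩
  obtain ⟨cfg1, h1⟩ := Option.isSome_iff_exists.1 (hr n)
  exact (key n _ h1).2

theorem Sol.pos_le {q : Q} {d : A} {c : ℕ → A} (h : M.Sol q d c)
    (hr : ∀ n, (M.run q d n).isSome) (n : ℕ) : (M.trace c q n).2 ≤ n := by
  obtain ⟨cfg1, h1⟩ := Option.isSome_iff_exists.1 (hr n)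
  obtain ⟨_, h2, h3, _⟩ := h.inv M n _ h1
  have := List.length_pos_iff.2 h2
  omega

/-- Reaching a paradoxical configuration excludes solutions. -/
theorem no_sol {q h : Q} {d a : A} {c : ℕ → A} (hs : M.Sol q d c) {n : ℕ}
    (hr : M.run q d n = some (h, [a])) (h0 : M.d0 h = none) (h1 : M.d1 h a = none)
    (h2 : ∀ b, (M.d2 h a b).2 ≠ b) : False := by
  obtain ⟨e1, _, e3, e4⟩ := hs.inv M n _ hr
  have e5 := hs.2 n
  simp only [out, rule] at e5
  have e6 := e4 0 (by simp)
  simp only [List.getElem_cons_zero, Nat.add_zero] at e6 e1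
  simp only [List.length_singleton, Nat.add_right_cancel_iff] at e3
  rw [← e1, h0, ← e6] at e5
  simp only [h1, e3] at e5
  exact h2 _ e5.symm

end AQM

/-! ### Distributive laws for queue machine specifications -/

namespace QMTable

/-- Terms over the signature of `T`. -/
abbrev Tm (T : QMTable) (X : Type) : Type := Term (Option (Fin T.nQ)) T.sig X

theorem op_none (T : QMTable) {X : Type} (ts : Fin (T.sig none) → T.Tm X) :
    Term.op none ts = T.CT X := by
  unfold CT
  congr 1
  funext i
  exact Fin.elim0 i

theorem op_some (T : QMTable) {X : Type} (q : Fin T.nQ) (ts : Fin (T.sig (some q)) → T.Tm X) :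
    Term.op (some q) ts = T.qTm q (ts (0 : Fin 1)) := by
  unfold qTm
  congr 1
  funext i
  congr 1
  exact Subsingleton.elim (α := Fin 1) _ _

theorem tm_ind (T : QMTable) {X : Type} {P : T.Tm X → Prop} (hv : ∀ x, P (Term.var x))
    (hC : P (T.CT X)) (hq : ∀ q t, P t → P (T.qTm q t)) (t : T.Tm X) : P t := by
  induction t with
  | var x => exact hv x
  | op o ts ih =>
    cases o with
    | none => rw [op_none]; exact hC
    | some q => rw [op_some]; exact hq _ _ (ih _)

@[simp] theorem map_var (T : QMTable) {X Y : Type} (f : X → Y) (x : X) :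
    (Term.var x : T.Tm X).map f = Term.var (f x) := rfl
@[simp] theorem map_CT (T : QMTable) {X Y : Type} (f : X → Y) :
    (T.CT X).map f = T.CT Y := by
  rw [← T.op_none (X := Y) (fun i => ((Fin.elim0 i : T.Tm X)).map f)]; rfl
@[simp] theorem map_qTm (T : QMTable) {X Y : Type} (f : X → Y) (q : Fin T.nQ) (t : T.Tm X) :
    (T.qTm q t).map f = T.qTm q (t.map f) := rfl
@[simp] theorem join_var (T : QMTable) {X : Type} (t : T.Tm X) :
    (Term.var t : T.Tm (T.Tm X)).join = t := rfl
@[simp] theorem join_CT (T : QMTable) {X : Type} :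
    (T.CT (T.Tm X)).join = T.CT X := by
  rw [← T.op_none (X := X) (fun i => ((Fin.elim0 i : T.Tm (T.Tm X))).join)]; rfl
@[simp] theorem join_qTm (T : QMTable) {X : Type} (q : Fin T.nQ) (t : T.Tm (T.Tm X)) :
    (T.qTm q t).join = T.qTm q t.join := rfl

/-- Labels of a stream. -/
def lab {Z A : Type} (s : Stream' (Z × A)) : ℕ → A := fun n => (s n).2

theorem map_get {Z Y A : Type} (g : Z → Y) (s : Stream' (Z × A)) (n : ℕ) :
    Stream'.map (Prod.map g id) s n = (g (s n).1, (s n).2) := rfl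

theorem lab_map {Z Y A : Type} (g : Z → Y) (s : Stream' (Z × A)) :
    lab (Stream'.map (Prod.map g id) s) = lab s := rfl

theorem drop_get {Z : Type} (s : Stream' Z) (k n : ℕ) : (s.drop k) n = s (k + n) := by
  show s (n + k) = s (k + n)
  rw [Nat.add_comm]

variable {T : QMTable} (M : AQM (Fin T.nQ) (Fin T.nA))

/-- The operation `q` on streams. -/
def opq {X : Type} (q : Fin T.nQ) (s : Stream' (T.Tm X × Fin T.nA)) :
    Stream' (T.Tm X × Fin T.nA) := fun n =>
  (T.qTm (M.trace (lab s) q n).1 (s (M.trace (lab s) q n).2).1, M.out (lab s) q n)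

theorem opq_map {X Y : Type} (g : T.Tm X → T.Tm Y) (hg : ∀ q t, g (T.qTm q t) = T.qTm q (g t))
    (q : Fin T.nQ) (s : Stream' (T.Tm X × Fin T.nA)) :
    opq M q (Stream'.map (Prod.map g id) s) = Stream'.map (Prod.map g id) (opq M q s) := by
  funext n
  rw [map_get]
  simp only [opq, lab_map, hg, map_get]

theorem lab_drop {Z A : Type} (s : Stream' (Z × A)) (k : ℕ) :
    lab (s.drop k) = fun i => lab s (k + i) := by
  funext n
  simp only [lab, drop_get]

theorem opq_drop {X : Type} (q : Fin T.nQ) (s : Stream' (T.Tm X × Fin T.nA)) (n : ℕ) :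
    (opq M q s).drop n = opq M (M.trace (lab s) q n).1 (s.drop (M.trace (lab s) q n).2) := by
  funext m
  rw [drop_get]
  simp only [opq, lab_drop, drop_get]
  rw [M.out_add, M.trace_add]

/-- The law determined by the stream of the constant. -/
def lawF (D : (X : Type) → Stream' (T.Tm X × Fin T.nA)) (X : Type) :
    T.Tm (Stream' (X × Fin T.nA)) → Stream' (T.Tm X × Fin T.nA)
  | Term.var σ => Stream'.map (Prod.map Term.var id) σ
  | Term.op none _ => D X
  | Term.op (some q) ts => opq M q (lawF D X (ts (0 : Fin 1)))

variable (D : (X : Type) → Stream' (T.Tm X × Fin T.nA))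

theorem lawF_var (X : Type) (σ : Stream' (X × Fin T.nA)) :
    lawF M D X (Term.var σ) = Stream'.map (Prod.map Term.var id) σ := by
  rw [lawF]
theorem lawF_CT (X : Type) : lawF M D X (T.CT _) = D X := by
  rfl
theorem lawF_qTm (X : Type) (q : Fin T.nQ) (t : T.Tm (Stream' (X × Fin T.nA))) :
    lawF M D X (T.qTm q t) = opq M q (lawF M D X t) := by
  rfl

/-- The states of the stream of `C`. -/
def cTerm (M : AQM (Fin T.nQ) (Fin T.nA)) (c : ℕ → Fin T.nA) (q : Fin T.nQ)
    (X : Type) : ℕ → T.Tm X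
  | 0 => T.CT X
  | n + 1 => T.qTm (M.trace c q n).1
      (if _h : (M.trace c q n).2 ≤ n then cTerm M c q X (M.trace c q n).2 else T.CT X)
termination_by n => n
decreasing_by omega

/-- The stream of `C`. -/
def cStream (M : AQM (Fin T.nQ) (Fin T.nA)) (c : ℕ → Fin T.nA) (q : Fin T.nQ)
    (X : Type) : Stream' (T.Tm X × Fin T.nA) := fun n => (cTerm M c q X n, c n)

/-- What we need about the stream of the constant. -/
structure Good (q1 : Fin T.nQ) (d : Fin T.nA) (c : ℕ → Fin T.nA) : Prop where
  lab_eq : ∀ X, lab (D X) = c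
  zero : ∀ X, (D X) 0 = (T.CT X, d)
  succ : ∀ X, (D X).drop 1 = opq M q1 (D X)
  pos : ∀ n, (M.trace c q1 n).2 ≤ n
  inv : ∀ X Y (g : T.Tm X → T.Tm Y), g (T.CT X) = T.CT Y →
    (∀ q t, g (T.qTm q t) = T.qTm q (g t)) → Stream'.map (Prod.map g id) (D X) = D Y

theorem good_cStream {q1 : Fin T.nQ} {d : Fin T.nA} {c : ℕ → Fin T.nA} (hs : M.Sol q1 d c)
    (hpos : ∀ n, (M.trace c q1 n).2 ≤ n) : Good M (cStream M c q1) q1 d c where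
  lab_eq X := rfl
  zero X := by
    simp only [cStream]
    rw [cTerm, hs.1]
  succ X := by
    funext n
    rw [drop_get]
    have : lab (cStream M c q1 X) = c := rfl
    simp only [opq, this]
    simp only [cStream]
    rw [Nat.add_comm 1 n, cTerm, hs.2, dif_pos (hpos n)]
  pos := hpos
  inv X Y g h1 h2 := by
    funext n
    rw [map_get]
    have : ∀ n, g (cTerm M c q1 X n) = cTerm M c q1 Y n := by
      intro n
      induction n using Nat.strong_induction_on with
      | _ n ih =>
        cases n with
        | zero => rw [cTerm, cTerm, h1]
        | succ n =>
          rw [cTerm, cTerm, h2, dif_pos (hpos n), dif_pos (hpos n)]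
          rw [ih _ (by have := hpos n; omega)]
    simp only [cStream, this]

variable {D} {q1 : Fin T.nQ} {d : Fin T.nA} {c : ℕ → Fin T.nA}

theorem lawF_natural (hG : Good M D q1 d c) (X Y : Type) (f : X → Y)
    (u : T.Tm (Stream' (X × Fin T.nA))) :
    lawF M D Y (u.map (Stream'.map (Prod.map f id))) =
      Stream'.map (Prod.map (Term.map f) id) (lawF M D X u) := by
  induction u using T.tm_ind with
  | hv σ => rw [map_var, lawF_var, lawF_var]; rfl
  | hC => rw [map_CT, lawF_CT, lawF_CT, hG.inv _ _ _ (T.map_CT f) (T.map_qTm f)]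
  | hq q t ih =>
    rw [map_qTm, lawF_qTm, ih, lawF_qTm, opq_map M _ (T.map_qTm f)]

theorem lawF_counit (hG : Good M D q1 d c) (X : Type) (u : T.Tm (Stream' (X × Fin T.nA))) :
    (lawF M D X u 0).1 = u.map fun σ => (σ 0).1 := by
  induction u using T.tm_ind with
  | hv σ => rw [map_var, lawF_var]; rfl
  | hC => rw [map_CT, lawF_CT, hG.zero]
  | hq q t ih => rw [map_qTm, lawF_qTm, ← ih]; rfl

theorem lawF_mult (hG : Good M D q1 d c) (X : Type)
    (u : T.Tm (T.Tm (Stream' (X × Fin T.nA)))) :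
    lawF M D X u.join =
        Stream'.map (Prod.map Term.join id) (lawF M D (T.Tm X) (u.map (lawF M D X))) := by
  induction u using T.tm_ind with
  | hv t => rw [map_var, lawF_var, join_var]; rfl
  | hC => rw [map_CT, join_CT, lawF_CT, lawF_CT, hG.inv _ _ _ T.join_CT T.join_qTm]
  | hq q t ih => rw [join_qTm, map_qTm, lawF_qTm, ih, lawF_qTm, opq_map M _ T.join_qTm]

theorem lawF_comult (hG : Good M D q1 d c) (X : Type) (u : T.Tm (Stream' (X × Fin T.nA))) :
    Stream'.map (Prod.map (lawF M D X) id) (lawF M D (Stream' (X × Fin T.nA)) (u.map sTails)) =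
        sTails (lawF M D X u) := by
  have key : ∀ n, lawF M D X (lawF M D (Stream' (X × Fin T.nA)) (u.map sTails) n).1 =
      (lawF M D X u).drop n ∧
      lab (lawF M D (Stream' (X × Fin T.nA)) (u.map sTails)) n = lab (lawF M D X u) n := by
    induction u using T.tm_ind with
    | hv σ =>
      intro n
      rw [map_var, lawF_var, lawF_var]
      exact ⟨rfl, rfl⟩
    | hC =>
      intro n
      rw [map_CT, lawF_CT, lawF_CT, hG.lab_eq, hG.lab_eq]
      refine ⟨?_, rfl⟩
      induction n using Nat.strong_induction_on with
      | _ n ih =>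
        cases n with
        | zero => rw [hG.zero, lawF_CT]; rfl
        | succ n =>
          have h1 := congrFun (hG.succ (Stream' (X × Fin T.nA))) n
          rw [drop_get, Nat.add_comm 1 n] at h1
          rw [h1]
          simp only [opq, hG.lab_eq]
          rw [lawF_qTm, ih _ (by have := hG.pos n; omega)]
          have h2 := opq_drop M q1 (D X) n
          rw [hG.lab_eq] at h2
          rw [← h2, ← hG.succ, Stream'.drop_drop, Nat.add_comm]
    | hq q t ih =>
      intro n
      have hl : lab (lawF M D (Stream' (X × Fin T.nA)) (t.map sTails)) = lab (lawF M D X t) :=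
        funext fun n => (ih n).2
      rw [map_qTm, lawF_qTm, lawF_qTm]
      constructor
      · simp only [opq, hl]
        rw [lawF_qTm, (ih _).1, ← opq_drop]
      · show M.out (lab _) q n = M.out (lab _) q n
        rw [hl]
  funext n
  rw [map_get]
  exact Prod.ext (key n).1 (key n).2

/-- The distributive law. -/
def mkLaw (hG : Good M D q1 d c) : DistLaw (Option (Fin T.nQ)) T.sig (Fin T.nA) where
  law := lawF M D
  natural := lawF_natural M hG
  ax_unit := lawF_var M D
  ax_counit := lawF_counit M hG
  ax_mult := lawF_mult M hG
  ax_comult := lawF_comult M hG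

/-- Uniform reformulation of `ExtendsRho`. -/
def Ext (q1 : Fin T.nQ) (d : Fin T.nA)
    (lam : DistLaw (Option (Fin T.nQ)) T.sig (Fin T.nA)) : Prop :=
  (∀ X : Type, firstTrans (lam.law X (T.CT (Stream' (X × Fin T.nA)))) = (d, T.qTm q1 (T.CT X))) ∧
  (∀ (X : Type) (q : Fin T.nQ) (σ : Stream' (X × Fin T.nA)),
    firstTrans (lam.law X (T.qTm q (Term.var σ))) =
      ((M.rule q (σ 0).2 (σ 1).2).1.2,
        T.qTm (M.rule q (σ 0).2 (σ 1).2).1.1 (Term.var (σ (M.rule q (σ 0).2 (σ 1).2).2).1)))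

theorem ext_mkLaw (hG : Good M D q1 d c) : Ext M q1 d (mkLaw M hG) := by
  constructor
  · intro X
    show firstTrans (lawF M D X (T.CT _)) = _
    rw [lawF_CT, firstTrans, hG.zero]
    have h1 := congrFun (hG.succ X) 0
    rw [drop_get] at h1
    rw [h1]
    simp [opq, AQM.trace, hG.zero]
  · intro X q σ
    show firstTrans (lawF M D X _) = _
    rw [lawF_qTm, lawF_var, firstTrans]
    simp only [opq, lab_map, AQM.out, AQM.trace, map_get]
    simp [lab]

section unique
variable {M}
variable {lam : DistLaw (Option (Fin T.nQ)) T.sig (Fin T.nA)}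

theorem Ext.law_drop (hE : Ext M q1 d lam) (X : Type) (q : Fin T.nQ) (σ : Stream' (X × Fin T.nA)) :
    (lam.law X (T.qTm q (Term.var σ))).drop 1 =
      lam.law X (T.qTm (M.rule q (σ 0).2 (σ 1).2).1.1
        (Term.var (σ.drop (M.rule q (σ 0).2 (σ 1).2).2))) := by
  have h1 := congrFun (lam.ax_comult X (T.qTm q (Term.var σ))) 1
  rw [map_get] at h1
  have h2 := congrArg Prod.fst h1
  have h3 := congrArg Prod.snd (hE.2 _ q (sTails σ))
  simp only [firstTrans] at h3
  simp only [sTails] at h2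
  rw [← h2]
  show lam.law X (lam.law (Stream' (X × Fin T.nA)) (T.qTm q (Term.var (sTails σ))) 1).1 = _
  rw [h3]
  rfl

theorem Ext.law_qvar (hE : Ext M q1 d lam) (X : Type) (q : Fin T.nQ) (σ : Stream' (X × Fin T.nA)) :
    lam.law X (T.qTm q (Term.var σ)) = opq M q (Stream'.map (Prod.map Term.var id) σ) := by
  funext n
  induction n generalizing q σ with
  | zero =>
    apply Prod.ext
    · rw [lam.ax_counit]; rfl
    · exact congrArg Prod.fst (hE.2 X q σ)
  | succ n ih =>
    have h1 := congrFun (hE.law_drop X q σ) n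
    rw [drop_get, Nat.add_comm] at h1
    rw [h1, ih]
    have h2 := congrFun (opq_drop M q (Stream'.map (Prod.map (Term.var (ar := T.sig)) id) σ) 1) n
    rw [drop_get, Nat.add_comm] at h2
    rw [h2]
    have e : (M.trace (lab (Stream'.map (Prod.map (Term.var (ar := T.sig)) id) σ)) q 1).2 =
        (M.rule q (σ 0).2 (σ 1).2).2 := by
      simp only [AQM.trace, lab, Nat.zero_add]
      rfl
    rw [e]
    rfl

theorem Ext.law_q (hE : Ext M q1 d lam) (X : Type) (q : Fin T.nQ) (t : T.Tm (Stream' (X × Fin T.nA))) :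
    lam.law X (T.qTm q t) = opq M q (lam.law X t) := by
  have h := lam.ax_mult X (T.qTm q (Term.var t))
  rw [join_qTm, join_var, map_qTm, map_var, hE.law_qvar] at h
  rw [h, ← opq_map M _ T.join_qTm]
  rfl

theorem Ext.law_C_zero (hE : Ext M q1 d lam) (X : Type) : lam.law X (T.CT _) 0 = (T.CT X, d) := by
  apply Prod.ext
  · rw [lam.ax_counit, map_CT]
  · exact congrArg Prod.fst (hE.1 X)

theorem Ext.law_C_drop (hE : Ext M q1 d lam) (X : Type) :
    (lam.law X (T.CT _)).drop 1 = opq M q1 (lam.law X (T.CT _)) := by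
  rw [← hE.law_q]
  have h1 := congrFun (lam.ax_comult X (T.CT _)) 1
  rw [map_get] at h1
  have h2 := congrArg Prod.fst h1
  have h3 := congrArg Prod.snd (hE.1 (Stream' (X × Fin T.nA)))
  simp only [firstTrans] at h3
  simp only [sTails] at h2
  rw [← h2, map_CT, h3]

theorem Ext.sol (hE : Ext M q1 d lam) (X : Type) : M.Sol q1 d (lab (lam.law X (T.CT _))) := by
  constructor
  · exact congrArg Prod.snd (hE.law_C_zero X)
  · intro n
    have h := congrFun (hE.law_C_drop X) n
    rw [drop_get, Nat.add_comm] at h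
    exact congrArg Prod.snd h

theorem Ext.unique (hE : Ext M q1 d lam) (hG : Good M D q1 d c) (hr : ∀ n, (M.run q1 d n).isSome) :
    lam = mkLaw M hG := by
  have hc : M.Sol q1 d c := by
    constructor
    · rw [← hG.lab_eq Unit]; exact congrArg Prod.snd (hG.zero Unit)
    · intro n
      have h := congrFun (hG.succ Unit) n
      rw [drop_get, Nat.add_comm] at h
      have h' := congrArg Prod.snd h
      simp only [opq, hG.lab_eq] at h'
      rw [← h', ← hG.lab_eq Unit]; rfl
  have hC : ∀ X, lam.law X (T.CT _) = D X := by
    intro X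
    have hl : lab (lam.law X (T.CT _)) = c := (hE.sol X).unique M hc hr
    funext n
    apply Prod.ext
    · induction n using Nat.strong_induction_on with
      | _ n ih =>
        cases n with
        | zero => rw [hE.law_C_zero, hG.zero]
        | succ n =>
          have h := congrFun (hE.law_C_drop X) n
          have h' := congrFun (hG.succ X) n
          rw [drop_get, Nat.add_comm] at h h'
          rw [h, h']
          simp only [opq, hl, hG.lab_eq]
          rw [ih _ (by have := hG.pos n; omega)]
    · show lab _ n = lab _ n
      rw [hl, hG.lab_eq]
  have : lam.law = (mkLaw M hG).law := by
    funext X u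
    show _ = lawF M D X u
    induction u using T.tm_ind with
    | hv σ => rw [lam.ax_unit, lawF_var]
    | hC => rw [hC, lawF_CT]
    | hq q t ih => rw [hE.law_q, ih, lawF_qTm]
  cases lam
  simp only [mkLaw] at this ⊢
  subst this
  rfl

end unique

/-- Decoding of table entries. -/
def toF (T : QMTable) (hV : T.Valid) (p : ℕ × ℕ) : Fin T.nQ × Fin T.nA :=
  if h : p.1 < T.nQ ∧ p.2 < T.nA then (⟨p.1, h.1⟩, ⟨p.2, h.2⟩) else (⟨0, hV.hQ⟩, ⟨0, hV.hA⟩)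

/-- The abstract queue machine of a valid table. -/
def aqm (T : QMTable) (hV : T.Valid) : AQM (Fin T.nQ) (Fin T.nA) where
  d0 q := (T.d0 q).map (T.toF hV)
  d1 q a := (T.d1 q a).map (T.toF hV)
  d2 q a b := T.toF hV ((T.d2 q a b).getD (0, 0))

theorem toF_eq (T : QMTable) (hV : T.Valid) (q : Fin T.nQ) (a : Fin T.nA) :
    T.toF hV (q.val, a.val) = (q, a) := by
  simp [toF]

theorem eq_toF (T : QMTable) (hV : T.Valid) (p : ℕ × ℕ) (h : p.1 < T.nQ ∧ p.2 < T.nA) :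
    p = ((T.toF hV p).1.val, (T.toF hV p).2.val) := by
  simp [toF, h]

theorem extendsRho_iff (T : QMTable) (hV : T.Valid)
    (lam : DistLaw (Option (Fin T.nQ)) T.sig (Fin T.nA)) :
    T.ExtendsRho hV lam ↔ Ext (T.aqm hV) ⟨T.q1, hV.hq1⟩ ⟨T.dollar, hV.hdollar⟩ lam := by
  constructor
  · rintro ⟨hC, h0, h1, h2⟩
    refine ⟨hC, fun X q σ => ?_⟩
    cases e0 : T.d0 q with
    | some r =>
      have hr := hV.range0 q q.2 r e0
      rw [T.eq_toF hV r hr] at e0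
      rw [h0 X q σ _ _ e0]
      simp [AQM.rule, aqm, e0, toF_eq]
    | none =>
      cases e1 : T.d1 q (σ 0).2 with
      | some r =>
        have hr := hV.range1 q q.2 _ (σ 0).2.2 r e1
        rw [T.eq_toF hV r hr] at e1
        rw [h1 X q σ _ _ e0 e1]
        simp [AQM.rule, aqm, e0, e1, toF_eq]
      | none =>
        cases e2 : T.d2 q (σ 0).2 (σ 1).2 with
        | some r =>
          have hr := hV.range2 q q.2 _ (σ 0).2.2 _ (σ 1).2.2 r e2
          rw [T.eq_toF hV r hr] at e2
          rw [h2 X q σ _ _ e0 e1 e2]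
          simp [AQM.rule, aqm, e0, e1, e2, toF_eq]
        | none =>
          have := hV.exactOne q q.2 _ (σ 0).2.2 _ (σ 1).2.2
          simp [e0, e1, e2] at this
  · rintro ⟨hC, h⟩
    refine ⟨hC, ?_, ?_, ?_⟩
    · intro X q σ q' c e0
      rw [h]; simp [AQM.rule, aqm, e0, toF_eq]
    · intro X q σ q' c e0 e1
      rw [h]; simp [AQM.rule, aqm, e0, e1, toF_eq]
    · intro X q σ q' c e0 e1 e2
      rw [h]; simp [AQM.rule, aqm, e0, e1, e2, toF_eq]

theorem existsUnique_of_run (T : QMTable) (hV : T.Valid)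
    (hr : ∀ n, ((T.aqm hV).run ⟨T.q1, hV.hq1⟩ ⟨T.dollar, hV.hdollar⟩ n).isSome) :
    ∃! lam : DistLaw (Option (Fin T.nQ)) T.sig (Fin T.nA), T.ExtendsRho hV lam := by
  obtain ⟨c, hc⟩ := AQM.Sol.exists _ hr
  have hG := good_cStream _ hc (hc.pos_le _ hr)
  refine ⟨mkLaw _ hG, (T.extendsRho_iff hV _).2 (ext_mkLaw _ hG), fun lam hl => ?_⟩
  exact ((T.extendsRho_iff hV _).1 hl).unique hG hr

theorem not_exists_of_stuck (T : QMTable) (hV : T.Valid) {n : ℕ} {h : Fin T.nQ} {a : Fin T.nA}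
    (hr : (T.aqm hV).run ⟨T.q1, hV.hq1⟩ ⟨T.dollar, hV.hdollar⟩ n = some (h, [a]))
    (h0 : (T.aqm hV).d0 h = none) (h1 : (T.aqm hV).d1 h a = none)
    (h2 : ∀ b, ((T.aqm hV).d2 h a b).2 ≠ b) :
    ¬ ∃ lam : DistLaw (Option (Fin T.nQ)) T.sig (Fin T.nA), T.ExtendsRho hV lam := by
  rintro ⟨lam, hl⟩
  exact AQM.no_sol _ (((T.extendsRho_iff hV _).1 hl).sol Unit) hr h0 h1 h2

end QMTable

/-! ### Simulating stack machines by queue machines -/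

namespace QSim
open Turing StateTransition Turing.PartrecToTM2

/-- Statements of the universal stack machine. -/
abbrev St := TM2.Stmt (fun _ : K' => Γ') Λ' (Option Γ')

abbrev Al := Option (K' ⊕ Γ')

abbrev mk (k : K') : Al := some (Sum.inl k)
abbrev sy (g : Γ') : Al := some (Sum.inr g)

/-- Control states. -/
inductive Ctl
  | exec (q : St) (v : Option Γ')
  | rot (q : St) (v : Option Γ')
  | emit (y : Al) (q : St) (v : Option Γ')

open Ctl

def after (y : Al) (q : St) (v : Option Γ') : Ctl := if y = none then exec q v else rot q v

def getS : Al → Option Γ'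
  | some (Sum.inr g) => some g
  | _ => none

def swp (y : Al) : Al := if y = none then mk K'.main else none

theorem swp_ne (y : Al) : swp y ≠ y := by
  unfold swp
  split
  · next h => rw [h]; simp
  · next h => exact fun h' => h h'.symm

def simD0 : Ctl → Option (Ctl × Al)
  | emit y q v => some (after y q v, y)
  | _ => none

def simD1 : Ctl → Al → Option (Ctl × Al)
  | rot q v, x => some (after x q v, x)
  | exec (TM2.Stmt.push k f q) v, x =>
    some (if x = mk k then emit (sy (f v)) q v else exec (TM2.Stmt.push k f q) v, x)
  | exec (TM2.Stmt.peek k f q) v, x =>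
    if x = mk k then none else some (exec (TM2.Stmt.peek k f q) v, x)
  | exec (TM2.Stmt.pop k f q) v, x =>
    if x = mk k then none else some (exec (TM2.Stmt.pop k f q) v, x)
  | exec (TM2.Stmt.load a q) v, x => some (after x q (a v), x)
  | exec (TM2.Stmt.branch p q1 q2) v, x => some (after x (cond (p v) q1 q2) v, x)
  | exec (TM2.Stmt.goto l) v, x => some (after x (tr (l v)) v, x)
  | exec TM2.Stmt.halt _, _ => none
  | emit _ _ _, _ => none

def simD2 : Ctl → Al → Al → Ctl × Al
  | exec (TM2.Stmt.peek _ f q) v, x, y => (emit y q (f v (getS y)), x)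
  | exec (TM2.Stmt.pop _ f q) v, x, y =>
    (if (getS y).isSome then rot q (f v (getS y)) else emit y q (f v (getS y)), x)
  | exec TM2.Stmt.halt v, _, y => (exec TM2.Stmt.halt v, swp y)
  | s, x, _ => (s, x)

/-- The simulating queue machine (with infinitely many, but essentially finitely many, states). -/
def sim : AQM Ctl Al := ⟨simD0, simD1, simD2⟩

abbrev Stk := K' → List Γ'

def seg (S : Stk) (k : K') : List Al := mk k :: (S k).map sy

def enc (S : Stk) : List Al :=
  seg S K'.main ++ (seg S K'.rev ++ (seg S K'.aux ++ (seg S K'.stack ++ [none])))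

theorem step_d0 {s : Ctl} {r : Ctl × Al} (h : sim.d0 s = some r) (w : List Al) :
    sim.step (s, w) = some (r.1, w ++ [r.2]) := by
  simp [AQM.step, h]

theorem step_d1 {s : Ctl} {x : Al} {r : Ctl × Al} (h0 : sim.d0 s = none)
    (h : sim.d1 s x = some r) (w : List Al) :
    sim.step (s, x :: w) = some (r.1, w ++ [r.2]) := by
  simp [AQM.step, h0, h]

theorem step_d2 {s : Ctl} {x y : Al} (h0 : sim.d0 s = none)
    (h : sim.d1 s x = none) (w : List Al) :
    sim.step (s, x :: y :: w) = some ((sim.d2 s x y).1, w ++ [(sim.d2 s x y).2]) := by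
  simp [AQM.step, h0, h]

abbrev R (a b : Ctl × List Al) : Prop := Reaches sim.step a b

theorem R.step {a b c : Ctl × List Al} (h : sim.step a = some b) (h' : R b c) : R a c :=
  Relation.ReflTransGen.head h h'

theorem R.of_eq {a b : Ctl × List Al} (h : a = b) : R a b := h ▸ Relation.ReflTransGen.refl

theorem loop {s : Ctl} (h0 : sim.d0 s = none) (u : List Al)
    (h : ∀ x ∈ u, sim.d1 s x = some (s, x)) (w : List Al) : R (s, u ++ w) (s, w ++ u) := by
  induction u generalizing w with
  | nil => exact R.of_eq (by simp)
  | cons x u ih =>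
    refine R.step (step_d1 h0 (h x (by simp)) _) ?_
    have := ih (fun y hy => h y (by simp [hy])) (w ++ [x])
    simpa using this

theorem rot_run (q : St) (v : Option Γ') (u w : List Al) (h : none ∉ u) :
    R (rot q v, u ++ none :: w) (exec q v, w ++ (u ++ [none])) := by
  refine Relation.ReflTransGen.trans (loop (s := rot q v) rfl u ?_ _) ?_
  · intro x hx
    have : x ≠ none := fun e => h (e ▸ hx)
    simp [sim, simD1, after, this]
  · refine R.step (step_d1 (r := (exec q v, none)) rfl (by simp [sim, simD1, after]) _) ?_
    exact R.of_eq (by simp)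

theorem emit_run (y : Al) (hy : y ≠ none) (q : St) (v : Option Γ') (u w : List Al) (h : none ∉ u) :
    R (emit y q v, u ++ none :: w) (exec q v, w ++ (y :: u ++ [none])) := by
  refine R.step (step_d0 (r := (rot q v, y)) (by simp [sim, simD0, after, hy]) _) ?_
  have := rot_run q v u (w ++ [y]) h
  simpa using this

theorem enc_cons (S : Stk) : ∃ x u, x ≠ none ∧ none ∉ u ∧ enc S = x :: (u ++ [none]) := by
  refine ⟨mk K'.main, (S K'.main).map sy ++ (seg S K'.rev ++ (seg S K'.aux ++ seg S K'.stack)),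
    by simp, by simp [seg], by simp [enc, seg]⟩

theorem enc_split (S : Stk) (k : K') : ∃ pre post : List Al, none ∉ pre ∧ mk k ∉ pre ∧
    none ∉ post ∧ (∀ y t, post = y :: t → getS y = none) ∧
    ∀ L, enc (Function.update S k L) = pre ++ (mk k :: (L.map sy ++ (post ++ [none]))) := by
  cases k with
  | main =>
    refine ⟨[], seg S K'.rev ++ (seg S K'.aux ++ seg S K'.stack), by simp, by simp,
      by simp [seg], ?_, ?_⟩
    · intro y t h
      simp only [seg, List.cons_append, List.cons.injEq] at h
      rw [← h.1]; rfl
    · intro L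
      simp [enc, seg, Function.update]
  | rev =>
    refine ⟨seg S K'.main, (seg S K'.aux ++ seg S K'.stack), by simp [seg], by simp [seg],
      by simp [seg], ?_, ?_⟩
    · intro y t h
      simp only [seg, List.cons_append, List.cons.injEq] at h
      rw [← h.1]; rfl
    · intro L
      simp [enc, seg, Function.update]
  | aux =>
    refine ⟨seg S K'.main ++ seg S K'.rev, seg S K'.stack, by simp [seg], by simp [seg],
      by simp [seg], ?_, ?_⟩
    · intro y t h
      simp only [seg, List.cons.injEq] at h
      rw [← h.1]; rfl
    · intro L
      simp [enc, seg, Function.update]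
  | stack =>
    refine ⟨seg S K'.main ++ (seg S K'.rev ++ seg S K'.aux), [], by simp [seg], by simp [seg],
      by simp [seg], ?_, ?_⟩
    · intro y t h
      simp at h
    · intro L
      simp [enc, seg, Function.update]

theorem enc_split' (S : Stk) (k : K') : ∃ pre post : List Al, none ∉ pre ∧ mk k ∉ pre ∧
    none ∉ post ∧ (∀ y t, post = y :: t → getS y = none) ∧
    enc S = pre ++ (mk k :: ((S k).map sy ++ (post ++ [none]))) ∧
    ∀ L, enc (Function.update S k L) = pre ++ (mk k :: (L.map sy ++ (post ++ [none]))) := by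
  obtain ⟨pre, post, h1, h2, h3, h4, h5⟩ := enc_split S k
  refine ⟨pre, post, h1, h2, h3, h4, ?_, h5⟩
  have := h5 (S k)
  rwa [Function.update_eq_self] at this

theorem none_notMem_map (L : List Γ') : (none : Al) ∉ L.map sy := by simp

theorem push_run (k : K') (f : Option Γ' → Γ') (q : St) (v : Option Γ') (S : Stk) :
    R (exec (TM2.Stmt.push k f q) v, enc S)
      (exec q v, enc (Function.update S k (f v :: S k))) := by
  obtain ⟨pre, post, h1, h2, h3, h4, h5, h6⟩ := enc_split' S k
  rw [h5, h6]
  refine Relation.ReflTransGen.trans (loop (s := exec (TM2.Stmt.push k f q) v) rfl pre ?_ _) ?_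
  · intro x hx
    have : x ≠ mk k := fun e => h2 (e ▸ hx)
    simp [sim, simD1, this]
  refine R.step (step_d1 (r := (emit (sy (f v)) q v, mk k)) rfl (by simp [sim, simD1]) _) ?_
  have := emit_run (sy (f v)) (by simp) q v ((S k).map sy ++ post) (pre ++ [mk k]) (by simp [h3])
  simpa using this

theorem peek_run (k : K') (f : Option Γ' → Option Γ' → Option Γ') (q : St) (v : Option Γ')
    (S : Stk) :
    R (exec (TM2.Stmt.peek k f q) v, enc S) (exec q (f v (S k).head?), enc S) := by
  obtain ⟨pre, post, h1, h2, h3, h4, h5, h6⟩ := enc_split' S k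
  rw [h5]
  refine Relation.ReflTransGen.trans (loop (s := exec (TM2.Stmt.peek k f q) v) rfl pre ?_ _) ?_
  · intro x hx
    have : x ≠ mk k := fun e => h2 (e ▸ hx)
    simp [sim, simD1, this]
  have hn : sim.d1 (exec (TM2.Stmt.peek k f q) v) (mk k) = none := by simp [sim, simD1]
  cases hS : S k with
  | cons g L =>
    refine R.step (step_d2 rfl hn _) ?_
    have := emit_run (sy g) (by simp) q (f v (some g)) (L.map sy ++ post) (pre ++ [mk k])
      (by simp [h3])
    simpa [sim, simD2, getS] using this
  | nil =>
    cases post with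
    | nil =>
      refine R.step (step_d2 rfl hn _) ?_
      refine R.step (step_d0 (r := (exec q (f v none), none)) (by rfl) _) ?_
      exact R.of_eq (by simp [sim, simD2])
    | cons y t =>
      have hy := h4 y t rfl
      simp only [List.mem_cons, not_or] at h3
      refine R.step (step_d2 rfl hn _) ?_
      have := emit_run y (fun e => h3.1 e.symm) q (f v none) t (pre ++ [mk k]) h3.2
      simpa [sim, simD2, hy] using this

theorem pop_run (k : K') (f : Option Γ' → Option Γ' → Option Γ') (q : St) (v : Option Γ')
    (S : Stk) :
    R (exec (TM2.Stmt.pop k f q) v, enc S)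
      (exec q (f v (S k).head?), enc (Function.update S k (S k).tail)) := by
  obtain ⟨pre, post, h1, h2, h3, h4, h5, h6⟩ := enc_split' S k
  rw [h5, h6]
  refine Relation.ReflTransGen.trans (loop (s := exec (TM2.Stmt.pop k f q) v) rfl pre ?_ _) ?_
  · intro x hx
    have : x ≠ mk k := fun e => h2 (e ▸ hx)
    simp [sim, simD1, this]
  have hn : sim.d1 (exec (TM2.Stmt.pop k f q) v) (mk k) = none := by simp [sim, simD1]
  cases hS : S k with
  | cons g L =>
    refine R.step (step_d2 rfl hn _) ?_
    have := rot_run q (f v (some g)) (L.map sy ++ post) (pre ++ [mk k]) (by simp [h3])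
    simpa [sim, simD2, getS] using this
  | nil =>
    cases post with
    | nil =>
      refine R.step (step_d2 rfl hn _) ?_
      refine R.step (step_d0 (r := (exec q (f v none), none)) (by rfl) _) ?_
      exact R.of_eq (by simp [sim, simD2])
    | cons y t =>
      have hy := h4 y t rfl
      simp only [List.mem_cons, not_or] at h3
      refine R.step (step_d2 rfl hn _) ?_
      have := emit_run y (fun e => h3.1 e.symm) q (f v none) t (pre ++ [mk k]) h3.2
      simpa [sim, simD2, hy] using this

theorem skip_run {s : Ctl} {q : St} {v : Option Γ'} (h0 : sim.d0 s = none)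
    (h1 : ∀ x, sim.d1 s x = some (after x q v, x)) (S : Stk) :
    Reaches₁ sim.step (s, enc S) (exec q v, enc S) := by
  obtain ⟨x, u, hx, hu, e⟩ := enc_cons S
  rw [e]
  refine Relation.TransGen.head' (step_d1 h0 (h1 x) _) ?_
  have := rot_run q v u [x] hu
  show R _ _
  simpa [after, hx] using this

theorem halt_run (v : Option Γ') (a : Al) (w : List Al) :
    ∃ b, R (exec TM2.Stmt.halt v, a :: w) (exec TM2.Stmt.halt v, [b]) := by
  induction hn : w.length generalizing a w with
  | zero =>
    rw [List.length_eq_zero_iff] at hn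
    subst hn
    exact ⟨a, Relation.ReflTransGen.refl⟩
  | succ n ih =>
    cases w with
    | nil => simp at hn
    | cons b w =>
      simp only [List.length_cons, Nat.add_right_cancel_iff] at hn
      have hs := step_d2 (s := exec TM2.Stmt.halt v) (x := a) (y := b) rfl rfl w
      cases w with
      | nil =>
        exact ⟨swp b, R.step hs Relation.ReflTransGen.refl⟩
      | cons c w =>
        obtain ⟨d, hd⟩ := ih c (w ++ [swp b]) (by simpa using hn)
        exact ⟨d, R.step hs (by simpa [sim, simD2] using hd)⟩

/-- The simulation relation. -/
def Rel (a : Cfg') (b : Ctl × List Al) : Prop :=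
  match a.l with
  | some l => b = (exec (tr l) a.var, enc a.stk)
  | none => ∃ v x, b = (exec TM2.Stmt.halt v, [x])

theorem stepAux_run (q : St) (v : Option Γ') (S : Stk) :
    ∃ b, Rel (TM2.stepAux q v S) b ∧ Reaches₁ sim.step (exec q v, enc S) b := by
  induction q generalizing v S with
  | push k f q ih =>
    obtain ⟨b, h1, h2⟩ := ih v (Function.update S k (f v :: S k))
    exact ⟨b, h1, Relation.TransGen.trans_right (push_run k f q v S) h2⟩
  | peek k f q ih =>
    obtain ⟨b, h1, h2⟩ := ih (f v (S k).head?) S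
    exact ⟨b, h1, Relation.TransGen.trans_right (peek_run k f q v S) h2⟩
  | pop k f q ih =>
    obtain ⟨b, h1, h2⟩ := ih (f v (S k).head?) (Function.update S k (S k).tail)
    exact ⟨b, h1, Relation.TransGen.trans_right (pop_run k f q v S) h2⟩
  | load a q ih =>
    obtain ⟨b, h1, h2⟩ := ih (a v) S
    exact ⟨b, h1, Relation.TransGen.trans (skip_run rfl (fun x => rfl) S) h2⟩
  | branch p q1 q2 ih1 ih2 =>
    have hs := skip_run (s := exec (TM2.Stmt.branch p q1 q2) v) rfl (fun x => rfl) S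
    cases hp : p v with
    | true =>
      obtain ⟨b, h1, h2⟩ := ih1 v S
      simp only [hp, cond_true] at hs
      exact ⟨b, by simpa [TM2.stepAux, hp] using h1, Relation.TransGen.trans hs h2⟩
    | false =>
      obtain ⟨b, h1, h2⟩ := ih2 v S
      simp only [hp, cond_false] at hs
      exact ⟨b, by simpa [TM2.stepAux, hp] using h1, Relation.TransGen.trans hs h2⟩
  | goto l =>
    exact ⟨_, rfl, skip_run rfl (fun x => rfl) S⟩
  | halt =>
    obtain ⟨x, u, hx, hu, e⟩ := enc_cons S
    rw [e]
    cases u with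
    | nil =>
      exact ⟨_, ⟨v, _, rfl⟩, Relation.TransGen.single (step_d2 rfl rfl [])⟩
    | cons y u =>
      obtain ⟨b, hb⟩ := halt_run v x (y :: u ++ [none])
      refine ⟨_, ⟨v, b, rfl⟩, ?_⟩
      rcases Relation.reflTransGen_iff_eq_or_transGen.1 hb with h | h
      · simp at h
      · exact h

theorem respects : Respects (TM2.step tr) sim.step Rel := by
  rintro ⟨l, v, S⟩ b h
  cases l with
  | some l =>
    simp only [Rel] at h
    subst h
    exact stepAux_run (tr l) v S
  | none =>
    obtain ⟨v, x, rfl⟩ := h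
    rfl

/-- Finite closed set of states. -/
def good (S0 : Finset Λ') : Ctl → Prop
  | exec q _ => some q ∈ TM2.stmts tr S0
  | rot q _ => some q ∈ TM2.stmts tr S0
  | emit _ q _ => some q ∈ TM2.stmts tr S0

instance : Finite K' :=
  Finite.of_surjective (fun i : Fin 4 => match i with
    | 0 => K'.main | 1 => K'.rev | 2 => K'.aux | 3 => K'.stack)
    (fun k => by cases k; exacts [⟨0, rfl⟩, ⟨1, rfl⟩, ⟨2, rfl⟩, ⟨3, rfl⟩])

theorem good_finite (S0 : Finset Λ') : {s | good S0 s}.Finite := by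
  let g : {q : St // some q ∈ TM2.stmts tr S0} × Option Γ' × Option (Option Al) → Ctl :=
    fun p => match p with
    | (q, v, none) => exec q v
    | (q, v, some none) => rot q v
    | (q, v, some (some y)) => emit y q v
  have : Finite {q : St // some q ∈ TM2.stmts tr S0} :=
    Finite.of_injective (β := {q // q ∈ TM2.stmts tr S0}) (fun q => ⟨some q.1, q.2⟩)
      (fun a b h => by simpa [Subtype.ext_iff] using h)
  refine (Set.finite_range g).subset ?_
  rintro s hs
  cases s with
  | exec q v => exact ⟨(⟨q, hs⟩, v, none), rfl⟩
  | rot q v => exact ⟨(⟨q, hs⟩, v, some none), rfl⟩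
  | emit y q v => exact ⟨(⟨q, hs⟩, v, some (some y)), rfl⟩

theorem good_after {S0 : Finset Λ'} {y : Al} {q : St} {v : Option Γ'}
    (h : some q ∈ TM2.stmts tr S0) : good S0 (after y q v) := by
  unfold after; split <;> exact h

theorem good_d0 {S0 : Finset Λ'} {s : Ctl} (h : good S0 s) :
    ∀ r, sim.d0 s = some r → good S0 r.1 := by
  rintro r hr
  cases s with
  | exec q v => cases hr
  | rot q v => cases hr
  | emit y q v =>
    cases hr
    exact good_after h

theorem mem_stmts_tr {S0 : Finset Λ'} {l : Λ'} (h : l ∈ S0) : some (tr l) ∈ TM2.stmts tr S0 := by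
  classical
  unfold TM2.stmts
  exact Finset.some_mem_insertNone.2 (Finset.mem_biUnion.2 ⟨l, h, TM2.stmts₁_self⟩)

theorem good_d1 {S0 : Finset Λ'} (hS : ∀ q ∈ S0, TM2.SupportsStmt S0 (tr q)) {s : Ctl}
    (h : good S0 s) (x : Al) : ∀ r, sim.d1 s x = some r → good S0 r.1 := by
  rintro r hr
  cases s with
  | emit y q v => cases hr
  | rot q v => cases hr; exact good_after h
  | exec q v =>
    cases q with
    | push k f q =>
      cases hr
      have : some q ∈ TM2.stmts tr S0 :=
        TM2.stmts_trans (by simp [TM2.stmts₁, TM2.stmts₁_self]) h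
      simp only
      split
      · exact this
      · exact h
    | peek k f q =>
      simp only [sim, simD1] at hr
      split at hr
      · cases hr
      · cases hr; exact h
    | pop k f q =>
      simp only [sim, simD1] at hr
      split at hr
      · cases hr
      · cases hr; exact h
    | load a q =>
      cases hr
      exact good_after (TM2.stmts_trans (by simp [TM2.stmts₁, TM2.stmts₁_self]) h)
    | branch p q1 q2 =>
      cases hr
      refine good_after (TM2.stmts_trans ?_ h)
      cases p v <;> simp [TM2.stmts₁, TM2.stmts₁_self]
    | goto l =>
      cases hr
      apply good_after
      have h' : TM2.SupportsStmt S0 (TM2.Stmt.goto l : St) := by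
        simp only [good, TM2.stmts, Finset.some_mem_insertNone, Finset.mem_biUnion] at h
        obtain ⟨a, ha, hb⟩ := h
        exact TM2.stmts₁_supportsStmt_mono hb (hS a ha)
      exact mem_stmts_tr (h' v)
    | halt => cases hr

theorem good_d2 {S0 : Finset Λ'} {s : Ctl}
    (h : good S0 s) (x y : Al) : good S0 (sim.d2 s x y).1 := by
  cases s with
  | emit y q v => exact h
  | rot q v => exact h
  | exec q v =>
    cases q with
    | peek k f q =>
      exact TM2.stmts_trans (q₁ := q) (by simp [TM2.stmts₁, TM2.stmts₁_self]) h
    | pop k f q =>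
      have : some q ∈ TM2.stmts tr S0 :=
        TM2.stmts_trans (by simp [TM2.stmts₁, TM2.stmts₁_self]) h
      simp only [sim, simD2]
      split
      · exact this
      · exact this
    | _ => exact h

end QSim

/-! ### Runs and evaluation -/

namespace AQM
open StateTransition
variable {Q A : Type} (M : AQM Q A)

theorem run_of_reaches {q : Q} {d : A} {b : Q × List A} (h : Reaches M.step (q, [d]) b) :
    ∃ n, M.run q d n = some b := by
  induction h with
  | refl => exact ⟨0, rfl⟩
  | tail _ h2 ih =>
    obtain ⟨n, hn⟩ := ih
    exact ⟨n + 1, by simp only [run, hn, Option.bind_some]; exact h2⟩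

theorem reaches_of_run {q : Q} {d : A} {b : Q × List A} {n : ℕ} (h : M.run q d n = some b) :
    Reaches M.step (q, [d]) b := by
  induction n generalizing b with
  | zero => simp only [run, Option.some.injEq] at h; subst h; exact Relation.ReflTransGen.refl
  | succ n ih =>
    simp only [run, Option.bind_eq_some_iff] at h
    obtain ⟨a, h1, h2⟩ := h
    exact Relation.ReflTransGen.tail (ih h1) h2

theorem run_isSome {q : Q} {d : A} (h : ¬ (eval M.step (q, [d])).Dom) (n : ℕ) :
    (M.run q d n).isSome := by
  induction n with
  | zero => rfl
  | succ n ih =>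
    obtain ⟨b, hb⟩ := Option.isSome_iff_exists.1 ih
    simp only [run, hb, Option.bind_some]
    by_contra hc
    simp only [Option.isSome_iff_ne_none, ne_eq, not_not] at hc
    have : b ∈ eval M.step (q, [d]) := mem_eval.2 ⟨M.reaches_of_run hb, hc⟩
    exact h (Part.dom_iff_mem.2 ⟨b, this⟩)

theorem step_map {Q' A' : Type} (M' : AQM Q' A') (fs : Q → Q') (fa : A → A') (s : Q)
    (h0 : M'.d0 (fs s) = (M.d0 s).map (Prod.map fs fa))
    (h1 : M.d0 s = none → ∀ x, M'.d1 (fs s) (fa x) = (M.d1 s x).map (Prod.map fs fa))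
    (h2 : M.d0 s = none → ∀ x, M.d1 s x = none → ∀ y,
      M'.d2 (fs s) (fa x) (fa y) = Prod.map fs fa (M.d2 s x y)) (w : List A) :
    M'.step (fs s, w.map fa) = (M.step (s, w)).map (Prod.map fs (List.map fa)) := by
  simp only [step]
  cases e0 : M.d0 s with
  | some r => rw [h0, e0]; simp
  | none =>
    rw [h0, e0]
    simp only [Option.map_none]
    cases w with
    | nil => rfl
    | cons x w =>
      have h1 := h1 e0 x
      simp only [List.map_cons]
      cases e1 : M.d1 s x with
      | some r => rw [h1, e1]; simp
      | none =>
        rw [h1, e1]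
        simp only [Option.map_none]
        cases w with
        | nil => rfl
        | cons y w =>
          simp only [List.map_cons]
          rw [h2 e0 x e1 y]
          simp

end AQM

namespace QSim
open Turing StateTransition Turing.PartrecToTM2 Ctl

theorem step_good {S0 : Finset Λ'} (hS : ∀ q ∈ S0, TM2.SupportsStmt S0 (tr q))
    {a b : Ctl × List Al} (h : good S0 a.1) (hs : sim.step a = some b) : good S0 b.1 := by
  obtain ⟨s, w⟩ := a
  simp only [AQM.step] at hs
  cases e0 : sim.d0 s with
  | some r => simp only [e0, Option.some.injEq] at hs; subst hs; exact good_d0 h r e0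
  | none =>
    simp only [e0] at hs
    cases w with
    | nil => cases hs
    | cons x w =>
      simp only at hs
      cases e1 : sim.d1 s x with
      | some r => simp only [e1, Option.some.injEq] at hs; subst hs; exact good_d1 hS h x r e1
      | none =>
        simp only [e1] at hs
        cases w with
        | nil => cases hs
        | cons y w => simp only [Option.some.injEq] at hs; subst hs; exact good_d2 h x y

/-- Numbering of states and letters. -/
structure Num (S0 : Finset Λ') where
  N : ℕ
  K : ℕ
  ns : Ctl → ℕ
  ds : ℕ → Ctl
  na : Al → ℕ
  da : ℕ → Al
  hns : ∀ s, ns s < N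
  hna : ∀ x, na x < K
  ds_ns : ∀ s, good S0 s → ds (ns s) = s
  da_na : ∀ x, da (na x) = x

theorem exists_num (S0 : Finset Λ') (s0 : Ctl) (h0 : good S0 s0) : Nonempty (Num S0) := by
  classical
  have hf : Finite {s // good S0 s} := (good_finite S0)
  let e := Finite.equivFin {s // good S0 s}
  let eA := Finite.equivFin Al
  refine ⟨{ N := Nat.card {s // good S0 s}, K := Nat.card Al
            ns := fun s => if h : good S0 s then e ⟨s, h⟩ else e ⟨s0, h0⟩
            ds := fun i => if h : i < Nat.card {s // good S0 s} then (e.symm ⟨i, h⟩).1 else s0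
            na := fun x => eA x
            da := fun i => if h : i < Nat.card Al then eA.symm ⟨i, h⟩ else none
            hns := ?_, hna := ?_, ds_ns := ?_, da_na := ?_ }⟩
  · intro s
    split <;> exact Fin.is_lt _
  · intro x
    exact Fin.is_lt _
  · intro s hs
    simp [hs]
  · intro x
    rw [dif_pos (Fin.is_lt _)]
    exact eA.symm_apply_apply x

namespace Num
variable {S0 : Finset Λ'} (c : Num S0)

def enc2 (r : Ctl × Al) : ℕ × ℕ := (c.ns r.1, c.na r.2)

def F0 (i : ℕ) : Option (ℕ × ℕ) := (sim.d0 (c.ds i)).map c.enc2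
def F1 (i a : ℕ) : Option (ℕ × ℕ) :=
  if sim.d0 (c.ds i) = none then (sim.d1 (c.ds i) (c.da a)).map c.enc2 else none
open Classical in
noncomputable def F2 (i a b : ℕ) : Option (ℕ × ℕ) :=
  if sim.d0 (c.ds i) = none ∧ sim.d1 (c.ds i) (c.da a) = none then
    some (c.enc2 (sim.d2 (c.ds i) (c.da a) (c.da b))) else none

/-- The table with initialisation word `R` (reversed) and start state `s0`. -/
noncomputable def table (s0 : Ctl) (R : List ℕ) : QMTable where
  nQ := c.N + R.length
  nA := c.K
  dollar := c.na (QSim.mk K'.main)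
  q1 := c.N + R.length - 1
  t0 := (List.range c.N).map c.F0 ++
    (List.range R.length).map (fun i => some (if i = 0 then c.ns s0 else c.N + i - 1, R.getD i 0))
  t1 := (List.range (c.N * c.K)).map (fun i => c.F1 (i / c.K) (i % c.K))
  t2 := (List.range (c.N * c.K * c.K)).map
    (fun i => c.F2 (i / c.K / c.K) (i / c.K % c.K) (i % c.K))

theorem mul_add_mod' {i a K : ℕ} (ha : a < K) : (i * K + a) % K = a := by
  rw [Nat.mul_comm, Nat.mul_add_mod, Nat.mod_eq_of_lt ha]

theorem getD_map_range {β : Type} (g : ℕ → β) (n i : ℕ) (d : β) :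
    ((List.range n).map g).getD i d = if i < n then g i else d := by
  rw [List.getD_eq_getElem?_getD]
  split
  · next h => simp [h]
  · next h => rw [List.getElem?_eq_none (by simp; omega)]; rfl

variable (s0 : Ctl) (R : List ℕ)

theorem table_d0_lt {i : ℕ} (h : i < c.N) : (c.table s0 R).d0 i = c.F0 i := by
  simp only [QMTable.d0, table]
  rw [List.getD_append _ _ _ _ (by simpa using h), getD_map_range, if_pos h]

theorem table_d0_ge {i : ℕ} (h : i < R.length) : (c.table s0 R).d0 (c.N + i) =
    some (if i = 0 then c.ns s0 else c.N + i - 1, R.getD i 0) := by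
  simp only [QMTable.d0, table]
  rw [List.getD_append_right _ _ _ _ (by simp), getD_map_range]
  simp [h]

theorem table_d1_lt {i a : ℕ} (h : i < c.N) (ha : a < c.K) :
    (c.table s0 R).d1 i a = c.F1 i a := by
  simp only [QMTable.d1, table]
  have hK : 0 < c.K := by omega
  rw [getD_map_range, if_pos (by nlinarith)]
  rw [mul_add_mod' ha, Nat.mul_comm, Nat.mul_add_div hK, Nat.div_eq_of_lt ha, Nat.add_zero]

theorem table_d1_ge {i a : ℕ} (h : c.N ≤ i) : (c.table s0 R).d1 i a = none := by
  simp only [QMTable.d1, table]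
  rw [getD_map_range, if_neg (by nlinarith)]

theorem table_d2_lt {i a b : ℕ} (h : i < c.N) (ha : a < c.K) (hb : b < c.K) :
    (c.table s0 R).d2 i a b = c.F2 i a b := by
  simp only [QMTable.d2, table]
  have hK : 0 < c.K := by omega
  have h1 : i * c.K + a < c.N * c.K := by nlinarith
  have h2 : ((i * c.K + a) * c.K + b) / c.K = i * c.K + a := by
    rw [Nat.mul_comm, Nat.mul_add_div hK, Nat.div_eq_of_lt hb, Nat.add_zero]
  have h3 : (i * c.K + a) / c.K = i := by
    rw [Nat.mul_comm, Nat.mul_add_div hK, Nat.div_eq_of_lt ha, Nat.add_zero]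
  rw [getD_map_range, if_pos (by nlinarith), h2, h3, mul_add_mod' ha,
    mul_add_mod' hb]

theorem table_d2_ge {i a b : ℕ} (h : c.N ≤ i) : (c.table s0 R).d2 i a b = none := by
  simp only [QMTable.d2, table]
  have h1 : c.N * c.K ≤ i * c.K + a := by nlinarith
  rw [getD_map_range, if_neg (by nlinarith)]

theorem ge_cases {i : ℕ} (h : i < (c.table s0 R).nQ) :
    i < c.N ∨ ∃ j, j < R.length ∧ i = c.N + j := by
  have : i < c.N + R.length := h
  rcases Nat.lt_or_ge i c.N with h | h
  · exact Or.inl h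
  · exact Or.inr ⟨i - c.N, by omega, by omega⟩

theorem enc2_lt (r : Ctl × Al) :
    (c.enc2 r).1 < (c.table s0 R).nQ ∧ (c.enc2 r).2 < (c.table s0 R).nA := by
  refine ⟨?_, c.hna _⟩
  have := c.hns r.1
  show c.ns r.1 < c.N + R.length
  omega

theorem valid (hR : R ≠ []) (hRK : ∀ x ∈ R, x < c.K) : (c.table s0 R).Valid where
  hQ := by have := c.hns s0; show 0 < c.N + R.length; omega
  hA := by have := c.hna none; show 0 < c.K; omega
  hdollar := c.hna _
  hq1 := by
    have := List.length_pos_iff.2 hR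
    show c.N + R.length - 1 < c.N + R.length; omega
  range0 := by
    intro q hq p hp
    rcases c.ge_cases s0 R hq with h | ⟨j, hj, rfl⟩
    · rw [c.table_d0_lt s0 R h, F0, Option.mem_def, Option.map_eq_some_iff] at hp
      obtain ⟨r, _, rfl⟩ := hp
      exact c.enc2_lt s0 R r
    · rw [c.table_d0_ge s0 R hj, Option.mem_def, Option.some.injEq] at hp
      subst hp
      constructor
      · have := c.hns s0
        show (if j = 0 then c.ns s0 else c.N + j - 1) < c.N + R.length
        split <;> omega
      · show R.getD j 0 < c.K
        rw [List.getD_eq_getElem _ _ hj]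
        exact hRK _ (List.getElem_mem hj)
  range1 := by
    intro q hq a ha p hp
    rcases c.ge_cases s0 R hq with h | ⟨j, hj, rfl⟩
    · rw [c.table_d1_lt s0 R h ha, F1, Option.mem_def] at hp
      split at hp
      · rw [Option.map_eq_some_iff] at hp
        obtain ⟨r, _, rfl⟩ := hp
        exact c.enc2_lt s0 R r
      · cases hp
    · rw [c.table_d1_ge s0 R (by omega)] at hp; cases hp
  range2 := by
    intro q hq a ha b hb p hp
    rcases c.ge_cases s0 R hq with h | ⟨j, hj, rfl⟩
    · rw [c.table_d2_lt s0 R h ha hb, F2, Option.mem_def] at hp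
      split at hp
      · rw [Option.some.injEq] at hp
        subst hp
        exact c.enc2_lt s0 R _
      · cases hp
    · rw [c.table_d2_ge s0 R (by omega)] at hp; cases hp
  exactOne := by
    intro q hq a ha b hb
    rcases c.ge_cases s0 R hq with h | ⟨j, hj, rfl⟩
    · rw [c.table_d0_lt s0 R h, c.table_d1_lt s0 R h ha, c.table_d2_lt s0 R h ha hb, F0, F1, F2]
      cases e0 : sim.d0 (c.ds q) with
      | some r => simp
      | none =>
        cases e1 : sim.d1 (c.ds q) (c.da a) with
        | some r => simp
        | none => simp
    · rw [c.table_d0_ge s0 R hj, c.table_d1_ge s0 R (by omega), c.table_d2_ge s0 R (by omega)]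
      simp

variable {R} (hV : (c.table s0 R).Valid)

/-- State and letter embeddings. -/
def fs (R : List ℕ) (s : Ctl) : Fin (c.table s0 R).nQ :=
  ⟨c.ns s, by have := c.hns s; show c.ns s < c.N + R.length; omega⟩
def fa (R : List ℕ) (x : Al) : Fin (c.table s0 R).nA := ⟨c.na x, c.hna x⟩

theorem toF_enc2 (r : Ctl × Al) :
    (c.table s0 R).toF hV (c.enc2 r) = Prod.map (c.fs s0 R) (c.fa s0 R) r :=
  (c.table s0 R).toF_eq hV (c.fs s0 R r.1) (c.fa s0 R r.2)

theorem aqm_d0 {s : Ctl} (hs : good S0 s) : ((c.table s0 R).aqm hV).d0 (c.fs s0 R s) =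
    (sim.d0 s).map (Prod.map (c.fs s0 R) (c.fa s0 R)) := by
  show ((c.table s0 R).d0 (c.ns s)).map _ = _
  rw [c.table_d0_lt s0 R (c.hns s), F0, c.ds_ns s hs, Option.map_map]
  congr 1
  funext r
  exact c.toF_enc2 s0 hV r

theorem aqm_d1 {s : Ctl} (hs : good S0 s) (h0 : sim.d0 s = none) (x : Al) :
    ((c.table s0 R).aqm hV).d1 (c.fs s0 R s) (c.fa s0 R x) =
    (sim.d1 s x).map (Prod.map (c.fs s0 R) (c.fa s0 R)) := by
  show ((c.table s0 R).d1 (c.ns s) (c.na x)).map _ = _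
  rw [c.table_d1_lt s0 R (c.hns s) (c.hna x), F1, c.ds_ns s hs, if_pos h0, c.da_na, Option.map_map]
  congr 1
  funext r
  exact c.toF_enc2 s0 hV r

theorem aqm_d2' {s : Ctl} (hs : good S0 s) (h0 : sim.d0 s = none) (x : Al)
    (h1 : sim.d1 s x = none) (b : Fin (c.table s0 R).nA) :
    ((c.table s0 R).aqm hV).d2 (c.fs s0 R s) (c.fa s0 R x) b =
    Prod.map (c.fs s0 R) (c.fa s0 R) (sim.d2 s x (c.da b)) := by
  show (c.table s0 R).toF hV (((c.table s0 R).d2 (c.ns s) (c.na x) b).getD (0, 0)) = _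
  rw [c.table_d2_lt s0 R (c.hns s) (c.hna x) b.2, F2, c.ds_ns s hs, c.da_na, if_pos ⟨h0, h1⟩]
  exact c.toF_enc2 s0 hV _

theorem respects2 (hS : ∀ q ∈ S0, TM2.SupportsStmt S0 (tr q)) :
    Respects sim.step ((c.table s0 R).aqm hV).step
      (fun a b => good S0 a.1 ∧ b = Prod.map (c.fs s0 R) (List.map (c.fa s0 R)) a) := by
  rintro ⟨s, w⟩ b ⟨hg, rfl⟩
  have h := AQM.step_map sim ((c.table s0 R).aqm hV) (c.fs s0 R) (c.fa s0 R) s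
    (c.aqm_d0 s0 hV hg) (fun h0 x => c.aqm_d1 s0 hV hg h0 x)
    (fun h0 x h1 y => by rw [c.aqm_d2' s0 hV hg h0 x h1]; simp [fa, c.da_na]) w
  cases e : sim.step (s, w) with
  | none => rw [e] at h; exact h
  | some r =>
    rw [e] at h
    exact ⟨_, ⟨step_good hS hg e, rfl⟩, Relation.TransGen.single h⟩

/-- The initialisation phase. -/
theorem init_run (l : List Al) (hl : R = (l.map c.na).reverse) (i : ℕ) (hi : i < R.length)
    (w : List Al) :
    Reaches ((c.table s0 R).aqm hV).step
      ((⟨c.N + i, by show c.N + i < c.N + R.length; omega⟩ : Fin (c.table s0 R).nQ),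
        w.map (c.fa s0 R))
      (c.fs s0 R s0, (w ++ (l.reverse.take (i + 1)).reverse).map (c.fa s0 R)) := by
  have hlen : R.length = l.reverse.length := by rw [hl]; simp
  induction i generalizing w with
  | zero =>
    have hx : 0 < l.reverse.length := by omega
    refine Relation.ReflTransGen.single ?_
    have h1 : R.getD 0 0 = c.na (l.reverse[0]) := by
      rw [List.getD_eq_getElem _ _ hi]
      simp only [hl, ← List.map_reverse, List.getElem_map]
    have h2 : ((c.table s0 R).aqm hV).d0 (⟨c.N + 0, by show c.N + 0 < c.N + R.length; omega⟩) =
        some (c.fs s0 R s0, c.fa s0 R (l.reverse[0])) := by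
      show ((c.table s0 R).d0 (c.N + 0)).map _ = _
      rw [c.table_d0_ge s0 R hi, h1]
      exact congrArg some (c.toF_enc2 s0 hV (s0, l.reverse[0]))
    simp only [AQM.step, h2, Option.mem_def, Option.some.injEq]
    rw [List.take_add_one]
    simp only [List.getElem?_eq_getElem hx]
    simp
  | succ i ih =>
    have hx : i + 1 < l.reverse.length := by omega
    have h1 : R.getD (i + 1) 0 = c.na (l.reverse[i + 1]) := by
      rw [List.getD_eq_getElem _ _ hi]
      simp only [hl, ← List.map_reverse, List.getElem_map]
    have h2 : ((c.table s0 R).aqm hV).d0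
        (⟨c.N + (i + 1), by show c.N + (i + 1) < c.N + R.length; omega⟩) =
        some (⟨c.N + i, by show c.N + i < c.N + R.length; omega⟩, c.fa s0 R (l.reverse[i + 1])) := by
      show ((c.table s0 R).d0 (c.N + (i + 1))).map _ = _
      rw [c.table_d0_ge s0 R hi, h1]
      exact congrArg some ((c.table s0 R).toF_eq hV
        ⟨c.N + i, by show c.N + i < c.N + R.length; omega⟩ (c.fa s0 R (l.reverse[i + 1])))
    refine Relation.ReflTransGen.head
      (b := (⟨c.N + i, by show c.N + i < c.N + R.length; omega⟩,
        (w ++ [l.reverse[i+1]]).map (c.fa s0 R))) ?_ ?_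
    · simp only [AQM.step, h2, Option.mem_def]
      simp
    · have := ih (by omega) (w ++ [l.reverse[i + 1]])
      rw [List.take_add_one (i := i + 1)]
      simp only [List.append_assoc] at this
      simp only [List.getElem?_eq_getElem hx, Option.toList_some, List.reverse_append,
        List.reverse_singleton]
      exact this

theorem init_run' (l : List Al) (hl : R = (l.map c.na).reverse) (hR : R ≠ []) :
    Reaches ((c.table s0 R).aqm hV).step
      (⟨(c.table s0 R).q1, hV.hq1⟩, [⟨(c.table s0 R).dollar, hV.hdollar⟩])
      (c.fs s0 R s0, (QSim.mk K'.main :: l).map (c.fa s0 R)) := by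
  have hp := List.length_pos_iff.2 hR
  have h := c.init_run s0 hV l hl (R.length - 1) (by omega) [QSim.mk K'.main]
  have e : R.length - 1 + 1 = l.reverse.length := by
    rw [Nat.sub_add_cancel hp, hl]; simp
  rw [e, List.take_length, List.reverse_reverse] at h
  have e2 : (⟨(c.table s0 R).q1, hV.hq1⟩ : Fin (c.table s0 R).nQ) =
      ⟨c.N + (R.length - 1), by show c.N + (R.length - 1) < c.N + R.length; omega⟩ := by
    apply Fin.ext
    show c.N + R.length - 1 = c.N + (R.length - 1)
    omega
  rw [e2]
  exact h

end Num

/-- Correctness of the reduction. -/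
theorem reduction {S0 : Finset Λ'} (c : Num S0) (hS : ∀ q ∈ S0, TM2.SupportsStmt S0 (tr q))
    (l0 : Λ') (hl0 : l0 ∈ S0) (S : Stk) (l : List Al) (hl : enc S = mk K'.main :: l)
    (R : List ℕ) (hR : R = (l.map c.na).reverse)
    (hV : (c.table (exec (tr l0) none) R).Valid) (hR0 : R ≠ []) :
    (∃! lam : DistLaw (Option (Fin (c.table (exec (tr l0) none) R).nQ))
        (c.table (exec (tr l0) none) R).sig (Fin (c.table (exec (tr l0) none) R).nA),
      (c.table (exec (tr l0) none) R).ExtendsRho hV lam) ↔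
    ¬ (eval (TM2.step tr) (⟨some l0, none, S⟩ : Cfg')).Dom := by
  have hg : good S0 (exec (tr l0) none) :=
    mem_stmts_tr hl0
  have hrel : Rel (⟨some l0, none, S⟩ : Cfg') (exec (tr l0) none, enc S) := rfl
  have hini := c.init_run' (exec (tr l0) none) hV l hR hR0
  rw [← hl] at hini
  have H2 := c.respects2 (exec (tr l0) none) hV hS
  constructor
  · intro hu hd
    obtain ⟨b, hb⟩ := Part.dom_iff_mem.1 hd
    obtain ⟨b2, hb2, hb3⟩ := tr_eval respects hrel hb
    obtain ⟨b3, ⟨hb4, rfl⟩, hb5⟩ := tr_eval H2 ⟨hg, rfl⟩ hb3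
    have hnone : b.l = none := by
      have := (mem_eval.1 hb).2
      obtain ⟨lb, vb, Sb⟩ := b
      cases lb with
      | none => rfl
      | some l => cases this
    simp only [Rel, hnone] at hb2
    obtain ⟨v, x, rfl⟩ := hb2
    have hreach := Relation.ReflTransGen.trans hini (mem_eval.1 hb5).1
    obtain ⟨n, hn⟩ := AQM.run_of_reaches _ hreach
    refine QMTable.not_exists_of_stuck _ hV hn ?_ ?_ ?_ hu.exists
    · rw [c.aqm_d0 _ hV hb4]; rfl
    · rw [c.aqm_d1 _ hV hb4 rfl]; rfl
    · intro b hb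
      rw [c.aqm_d2' _ hV hb4 rfl x rfl] at hb
      have hb' : c.na (swp (c.da b)) = b.val := congrArg Fin.val hb
      have hb'' := congrArg c.da hb'
      rw [c.da_na] at hb''
      exact swp_ne _ hb''
  · intro hd
    apply QMTable.existsUnique_of_run
    apply AQM.run_isSome
    rw [reaches_eval hini]
    rw [← tr_eval_dom respects hrel] at hd
    intro hd2
    exact hd ((tr_eval_dom H2 (a₁ := (exec (tr l0) none, enc S)) ⟨hg, rfl⟩).1 hd2)

end QSim


/-! ### Computability of the reduction -/

namespace QBits
open Turing.PartrecToTM2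

/-- Binary increment. -/
def inc (l : List Bool) : List Bool :=
  List.recOn l [true] (fun b t IH => if b = true then false :: IH else true :: t)

/-- Binary expansion, least significant digit first. -/
def bits (n : ℕ) : List Bool := Nat.rec [] (fun _ l => inc l) n

theorem inc_primrec : Primrec inc := by
  unfold inc
  refine Primrec.list_rec (h := fun _ p => if p.1 = true then false :: p.2.2 else true :: p.2.1)
    Primrec.id (Primrec.const [true]) ?_
  refine Primrec.ite ?_ ?_ ?_
  · exact Primrec.eq.comp (Primrec.fst.comp Primrec.snd) (Primrec.const true)
  · exact Primrec.list_cons.comp (Primrec.const false)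
      (Primrec.snd.comp (Primrec.snd.comp Primrec.snd))
  · exact Primrec.list_cons.comp (Primrec.const true)
      (Primrec.fst.comp (Primrec.snd.comp Primrec.snd))

theorem bits_primrec : Primrec bits :=
  Primrec.nat_rec₁ [] (f := fun _ l => inc l) (inc_primrec.comp Primrec.snd)

def sym (b : Bool) : Γ' := if b = true then Γ'.bit1 else Γ'.bit0

def posBits : PosNum → List Bool
  | PosNum.one => [true]
  | PosNum.bit0 n => false :: posBits n
  | PosNum.bit1 n => true :: posBits n

theorem posBits_succ (p : PosNum) : posBits p.succ = inc (posBits p) := by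
  induction p with
  | one => rfl
  | bit0 n ih => rfl
  | bit1 n ih =>
    show false :: posBits n.succ = false :: inc (posBits n)
    rw [ih]

theorem trPosNum_eq (p : PosNum) : trPosNum p = (posBits p).map sym := by
  induction p with
  | one => rfl
  | bit0 n ih => simp [trPosNum, posBits, ih, sym]
  | bit1 n ih => simp [trPosNum, posBits, ih, sym]

def numBits : Num → List Bool
  | Num.zero => []
  | Num.pos p => posBits p

theorem numBits_succ (p : Num) : numBits p.succ = inc (numBits p) := by
  cases p with
  | zero => rfl
  | pos p => exact posBits_succ p

theorem numBits_cast (n : ℕ) : numBits (n : Num) = bits n := by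
  induction n with
  | zero => rw [Nat.cast_zero]; rfl
  | succ n ih =>
    rw [Nat.cast_succ, Num.add_one, numBits_succ, ih]
    rfl

theorem trNat_eq (n : ℕ) : trNat n = (bits n).map sym := by
  rw [← numBits_cast, trNat]
  cases (n : Num) with
  | zero => rfl
  | pos p => exact trPosNum_eq p

end QBits

namespace QSim
open Turing StateTransition Turing.PartrecToTM2 Ctl

theorem table_primrec {S0 : Finset Λ'} (c : Num S0) (s0 : Ctl) :
    Primrec (fun R : List ℕ => c.table s0 R) := by
  have key : Primrec (fun R : List ℕ => qmTableEquiv (c.table s0 R)) := by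
    have hlen : Primrec (fun R : List ℕ => R.length) := Primrec.list_length
    have hadd : Primrec (fun R : List ℕ => c.N + R.length) :=
      Primrec.nat_add.comp (Primrec.const _) hlen
    refine Primrec.pair hadd (Primrec.pair (Primrec.const _) (Primrec.pair (Primrec.const _)
      (Primrec.pair (Primrec.nat_sub.comp hadd (Primrec.const 1)) (Primrec.pair ?_
        (Primrec.pair (Primrec.const _) (Primrec.const _))))))
    refine Primrec.list_append.comp (Primrec.const _) ?_
    refine Primrec.list_map (g := fun (R : List ℕ) i =>
      some (if i = 0 then c.ns s0 else c.N + i - 1, R.getD i 0))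
      (Primrec.list_range.comp hlen) ?_
    refine Primrec.option_some.comp (Primrec.pair ?_ ?_)
    · refine Primrec.ite (Primrec.eq.comp Primrec.snd (Primrec.const 0)) (Primrec.const _) ?_
      exact Primrec.nat_sub.comp (Primrec.nat_add.comp (Primrec.const _) Primrec.snd)
        (Primrec.const 1)
    · exact (Primrec.list_getD 0).comp Primrec.fst Primrec.snd
  exact (Primrec.of_equiv_symm_iff qmTableEquiv).2 key

/-- Reversed initial word, as numbers. -/
def initWord {S0 : Finset Λ'} (c : Num S0) (n : ℕ) : List ℕ :=
  [c.na none, c.na (mk K'.stack), c.na (mk K'.aux), c.na (mk K'.rev), c.na (sy Γ'.cons)] ++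
    ((QBits.bits n).map (fun b => if b = true then c.na (sy Γ'.bit1) else
      c.na (sy Γ'.bit0))).reverse

theorem initWord_primrec {S0 : Finset Λ'} (c : Num S0) : Primrec (initWord c) := by
  unfold initWord
  refine Primrec.list_append.comp (Primrec.const _) (Primrec.list_reverse.comp ?_)
  refine Primrec.list_map (g := fun (_ : ℕ) (b : Bool) =>
    if b = true then c.na (sy Γ'.bit1) else c.na (sy Γ'.bit0)) QBits.bits_primrec ?_
  exact Primrec.ite (Primrec.eq.comp Primrec.snd (Primrec.const true)) (Primrec.const _)
    (Primrec.const _)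

/-- Initial word. -/
def initTail (n : ℕ) : List Al :=
  (trNat n).map sy ++ [sy Γ'.cons, mk K'.rev, mk K'.aux, mk K'.stack, none]

theorem initWord_eq {S0 : Finset Λ'} (c : Num S0) (n : ℕ) :
    initWord c n = ((initTail n).map c.na).reverse := by
  have : (fun b => if b = true then c.na (sy Γ'.bit1) else c.na (sy Γ'.bit0)) =
      fun b => c.na (sy (QBits.sym b)) := by
    funext b
    cases b <;> rfl
  simp only [initWord, initTail, this, QBits.trNat_eq, List.map_append, List.map_map,
    List.reverse_append]
  rfl

theorem initTail_enc (n : ℕ) :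
    enc (K'.elim (trList [n]) [] [] []) = mk K'.main :: initTail n := by
  simp [enc, seg, initTail, trList]

theorem exists_universal : ∃ cd : ToPartrec.Code, ∀ n : ℕ,
    ((cd.eval [n]).Dom ↔
      (Nat.Partrec.Code.eval (Denumerable.ofNat Nat.Partrec.Code n) 0).Dom) := by
  have h : Partrec (fun n : ℕ => Nat.Partrec.Code.eval (Denumerable.ofNat Nat.Partrec.Code n) 0) :=
    Nat.Partrec.Code.eval_part.comp (Computable.ofNat _) (Computable.const 0)
  obtain ⟨cd, hcd⟩ := ToPartrec.Code.exists_code (Nat.Partrec'.part_iff₁.2 h)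
  refine ⟨cd, fun n => ?_⟩
  have := hcd ⟨[n], rfl⟩
  rw [show (⟨[n], rfl⟩ : List.Vector ℕ 1).1 = [n] from rfl] at this
  rw [this]
  exact Iff.rfl

end QSim

/-- **No rule format for distributive laws over stream systems.** It is undecidable
whether a given mixed-GSOS stream specification extends to a unique distributive law:
there is no algorithm (computable function, with respect to the natural encoding of
queue machines as natural numbers) deciding, for a queue machine `M`, whether the
induced stream biGSOS law `ρ_M` extends to exactly one distributive law. -/
theorem unique_distLaw_extension_undecidable :
    ¬ ∃ f : QMTable → Bool, Computable f ∧
      ∀ (T : QMTable) (hV : T.Valid),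
        (f T = true ↔
          ∃! lam : DistLaw (Option (Fin T.nQ)) T.sig (Fin T.nA), T.ExtendsRho hV lam) := by
  rintro ⟨f, hf, hspec⟩
  obtain ⟨cd, hcd⟩ := QSim.exists_universal
  have hsup := Turing.PartrecToTM2.tr_supports cd Turing.PartrecToTM2.Cont'.halt
  have hl0 : Turing.PartrecToTM2.trNormal cd Turing.PartrecToTM2.Cont'.halt ∈
      Turing.PartrecToTM2.codeSupp cd Turing.PartrecToTM2.Cont'.halt := hsup.1
  have hS : ∀ q ∈ Turing.PartrecToTM2.codeSupp cd Turing.PartrecToTM2.Cont'.halt,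
      Turing.TM2.SupportsStmt (Turing.PartrecToTM2.codeSupp cd Turing.PartrecToTM2.Cont'.halt)
        (Turing.PartrecToTM2.tr q) := fun q hq => hsup.2 q hq
  obtain ⟨c⟩ := QSim.exists_num _ (QSim.Ctl.exec (Turing.PartrecToTM2.tr
    (Turing.PartrecToTM2.trNormal cd Turing.PartrecToTM2.Cont'.halt)) none)
    (QSim.mem_stmts_tr hl0)
  have key : ∀ n : ℕ, f (c.table (QSim.Ctl.exec (Turing.PartrecToTM2.tr
      (Turing.PartrecToTM2.trNormal cd Turing.PartrecToTM2.Cont'.halt)) none)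
      (QSim.initWord c n)) = true ↔
      ¬ (Nat.Partrec.Code.eval (Denumerable.ofNat Nat.Partrec.Code n) 0).Dom := by
    intro n
    have hR0 : QSim.initWord c n ≠ [] := by simp [QSim.initWord]
    have hRK : ∀ x ∈ QSim.initWord c n, x < c.K := by
      intro x hx
      rw [QSim.initWord_eq, List.mem_reverse, List.mem_map] at hx
      obtain ⟨y, _, rfl⟩ := hx
      exact c.hna y
    have hV := c.valid (QSim.Ctl.exec (Turing.PartrecToTM2.tr
      (Turing.PartrecToTM2.trNormal cd Turing.PartrecToTM2.Cont'.halt)) none) _ hR0 hRK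
    rw [hspec _ hV, QSim.reduction c hS _ hl0 _ _ (QSim.initTail_enc n) _
      (QSim.initWord_eq c n) hV hR0, ← hcd n]
    have he := Turing.PartrecToTM2.tr_eval cd [n]
    unfold Turing.PartrecToTM2.init at he
    rw [he]
    exact Iff.rfl
  have hcomp : Computable (fun k : Nat.Partrec.Code => !(f (c.table (QSim.Ctl.exec
      (Turing.PartrecToTM2.tr
        (Turing.PartrecToTM2.trNormal cd Turing.PartrecToTM2.Cont'.halt)) none)
      (QSim.initWord c (Encodable.encode k))))) :=
    Primrec.not.to_comp.comp (hf.comp ((QSim.table_primrec c _).to_comp.comp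
      ((QSim.initWord_primrec c).to_comp.comp Computable.encode)))
  refine ComputablePred.halting_problem 0 (ComputablePred.computable_iff.2 ⟨_, hcomp, ?_⟩)
  funext k
  apply propext
  have hk := key (Encodable.encode k)
  rw [Denumerable.ofNat_encode] at hk
  rw [Bool.not_eq_true', Bool.eq_false_iff, ne_eq, hk, not_not]
end

section
/- Let λ_X : Σ*(B^∞ X) → B^∞(Σ* X) be any family of functions natural in X (stream setting, arbitrary signature Σ and label set A). Then for every set X and every u ∈ Σ*(B^∞ X): every variable x ∈ X that occurs in some term (state) of the output stream λ_X(u) already occurs as a state of some stream appearing in u. Moreover, the sequence of labels of λ_X(u) is invariant under relabeling of variables: for every function f : X → Y, the stream λ_Y obtained by applying λ after renaming all states in the streams of u along f has the same sequence of labels as λ_X(u), and its terms are obtained from those of λ_X(u) by substituting each variable x by f(x). -/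
namespace Term
variable {Op : Type} {ar : Op → ℕ}

/-- `x` occurs as a variable in a term. -/
def VOccurs {X : Type} (x : X) : Term Op ar X → Prop
  | var y => x = y
  | op _ ts => ∃ i, VOccurs x (ts i)

end Term

theorem Term.map_congr_of_occurs {Op : Type} {ar : Op → ℕ} {X Y : Type} (f g : X → Y)
    (t : Term Op ar X) (h : ∀ x, Term.VOccurs x t → f x = g x) : t.map f = t.map g := by
  induction t with
  | var x => simp only [Term.map]; rw [h x rfl]
  | op o ts ih =>
    simp only [Term.map]
    congr 1
    funext i
    exact ih i fun x hx => h x ⟨i, hx⟩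

theorem Term.eq_of_map_eq {Op : Type} {ar : Op → ℕ} {X Y : Type} (f g : X → Y)
    (t : Term Op ar X) (h : t.map f = t.map g) (x : X) (hx : Term.VOccurs x t) :
    f x = g x := by
  induction t with
  | var y =>
    simp only [Term.map, Term.var.injEq] at h
    have hxy : x = y := hx
    rw [hxy, h]
  | op o ts ih =>
    obtain ⟨i, hi⟩ := hx
    simp only [Term.map, Term.op.injEq, heq_eq_eq, true_and] at h
    exact ih i (congrFun h i) hi

/-- Let `λ_X : Σ*(B^∞ X) → B^∞(Σ* X)` be any family of functions natural in `X`
(stream setting `B X = A × X`, arbitrary signature). Then (a) every variable `x ∈ X`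
occurring in some state (term) of the output stream `λ_X(u)` already occurs as a state
of some stream appearing in `u`; and (b) for every relabeling `f : X → Y`, applying `λ`
after renaming all states of the input streams along `f` yields a stream with the same
sequence of labels as `λ_X(u)`, whose terms are obtained from those of `λ_X(u)` by
substituting each variable `x` by `f x`. -/
theorem natural_family_vars_and_labels (Op : Type) (ar : Op → ℕ) (A : Type)
    (law : ∀ X : Type, Term Op ar (Stream' (X × A)) → Stream' (Term Op ar X × A))
    (natural : ∀ (X Y : Type) (f : X → Y) (u : Term Op ar (Stream' (X × A))),
      law Y (u.map (Stream'.map (Prod.map f id))) =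
        Stream'.map (Prod.map (Term.map f) id) (law X u)) :
    (∀ (X : Type) (u : Term Op ar (Stream' (X × A))) (x : X) (n : ℕ),
      Term.VOccurs x (law X u n).1 →
      ∃ σ : Stream' (X × A), Term.VOccurs σ u ∧ ∃ m : ℕ, (σ m).1 = x) ∧
    (∀ (X Y : Type) (f : X → Y) (u : Term Op ar (Stream' (X × A))) (n : ℕ),
      (law Y (u.map (Stream'.map (Prod.map f id))) n).2 = (law X u n).2 ∧
      (law Y (u.map (Stream'.map (Prod.map f id))) n).1 = Term.map f (law X u n).1) := by
  have key : ∀ (X Y : Type) (f : X → Y) (u : Term Op ar (Stream' (X × A))) (n : ℕ),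
      law Y (u.map (Stream'.map (Prod.map f id))) n =
        (Term.map f (law X u n).1, (law X u n).2) := by
    intro X Y f u n
    rw [natural]
    rfl
  refine ⟨?_, ?_⟩
  · intro X u x n hx
    by_contra hne
    have hu : u.map (Stream'.map (Prod.map (fun y => y = x) (id : A → A))) =
        u.map (Stream'.map (Prod.map (fun _ => False) (id : A → A))) := by
      apply Term.map_congr_of_occurs
      intro σ hσ
      funext m
      have hm : ¬ (σ m).1 = x := fun e => hne ⟨σ, hσ, m, e⟩
      exact Prod.ext (eq_false hm) rfl
    have h1 := key X Prop (fun y => y = x) u n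
    rw [hu, key] at h1
    have h2 := Term.eq_of_map_eq _ _ _ (congrArg Prod.fst h1) x hx
    exact h2.symm.mp rfl
  · intro X Y f u n
    rw [key]
    exact ⟨rfl, rfl⟩
end
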